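/- arXiv:1303.3449 — 2 statements merged into one kernel-verified Lean document; each statement's English description precedes it below -/
import Mathlib

section
/- Let q be a prime power, n > 1 and 1 ≤ d < n integers, α ∈ 𝔽_{q^n} of degree n over 𝔽_q, and let k ≥ 1 be an integer such that q^{kd} ≥ q^{2n}·(n−1)^{2k}. Then every β ∈ 𝔽_{q^n}^× can be written as β = g₁(α)···g_k(α) for some g₁, …, g_k ∈ P_d (a product of exactly k elements of E_d). -/
open Polynomial

/-- A polynomial is primary if it is a positive power of a monic irreducible polynomial. -/
def IsPrimaryPoly {F : Type*} [Field F] (g : Polynomial F) : Prop :=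
  ∃ p : Polynomial F, p.Monic ∧ Irreducible p ∧ ∃ e : ℕ, 0 < e ∧ g = p ^ e

/-- `primarySet F d` is the set `P_d` of monic primary polynomials of degree `d` over `F`. -/
def primarySet (F : Type*) [Field F] (d : ℕ) : Set (Polynomial F) :=
  {g | g.Monic ∧ g.natDegree = d ∧ IsPrimaryPoly g}


lemma aux_finite_le (F : Type*) [Field F] [Finite F] (j : ℕ) :
    {f : F[X] | f.natDegree ≤ j}.Finite := by
  have h1 : Finite (degreeLT F (j + 1)) := Finite.of_equiv _ (degreeLTEquiv F (j + 1)).toEquiv.symm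
  refine Set.Finite.subset (Set.toFinite ((degreeLT F (j + 1) : Submodule F F[X]) : Set F[X])) ?_
  intro f hf
  rw [SetLike.mem_coe, mem_degreeLT]
  refine lt_of_le_of_lt degree_le_natDegree ?_
  have : f.natDegree ≤ j := hf
  exact_mod_cast Nat.lt_succ_of_le this

/-- monic polynomials of degree `j`. -/
noncomputable def monicFin (F : Type*) [Field F] [Finite F] (j : ℕ) : Finset F[X] :=
  ((aux_finite_le F j).subset (t := {f : F[X] | f.Monic ∧ f.natDegree = j})
    (fun _ h => h.2.le)).toFinset

/-- monic irreducible polynomials whose degree divides `i` (empty for `i = 0`). -/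
noncomputable def irrFin (F : Type*) [Field F] [Finite F] (i : ℕ) : Finset F[X] :=
  ((aux_finite_le F i).subset (t := {f : F[X] | f.Monic ∧ Irreducible f ∧ f.natDegree ∣ i ∧ f.natDegree ≤ i})
    (fun _ h => h.2.2.2)).toFinset

lemma mem_monicFin {F : Type*} [Field F] [Finite F] {j : ℕ} {f : F[X]} :
    f ∈ monicFin F j ↔ f.Monic ∧ f.natDegree = j := by simp [monicFin]

lemma mem_irrFin {F : Type*} [Field F] [Finite F] {j : ℕ} {f : F[X]} :
    f ∈ irrFin F j ↔ f.Monic ∧ Irreducible f ∧ f.natDegree ∣ j ∧ f.natDegree ≤ j := by simp [irrFin]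

/-- weighted sum over primary polynomials -/
noncomputable def sumS {F : Type*} [Field F] [Finite F] (ψ : F[X] →* ℂ) (i : ℕ) : ℂ :=
  ∑ p ∈ irrFin F i, (p.natDegree : ℂ) * ψ p ^ (i / p.natDegree)

open scoped Classical in
lemma aux_mangoldt {F : Type*} [Field F] [Finite F] (j : ℕ) (f : F[X]) (hf : f ∈ monicFin F j) :
    ∑ i ∈ Finset.range (j + 1), ∑ p ∈ irrFin F i with p ^ (i / p.natDegree) ∣ f, p.natDegree = j := by
  classical
  obtain ⟨hm, hd⟩ := mem_monicFin.1 hf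
  have hf0 := hm.ne_zero
  set s := UniqueFactorizationMonoid.normalizedFactors f with hs
  have hprod : s.prod = f := by
    have := leadingCoeff_mul_prod_normalizedFactors f
    rwa [hm.leadingCoeff, C_1, one_mul] at this
  have hmem : ∀ p, p ∈ s ↔ Irreducible p ∧ p.Monic ∧ p ∣ f := fun p =>
    Polynomial.mem_normalizedFactors_iff hf0
  have hcount : ∀ p, Irreducible p → p.Monic → ∀ k, p ^ k ∣ f ↔ k ≤ s.count p := by
    intro p hp hpm k
    rw [pow_dvd_iff_le_emultiplicity,
      UniqueFactorizationMonoid.emultiplicity_eq_count_normalizedFactors hp hf0, hpm.normalize_eq_self]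
    exact_mod_cast Iff.rfl
  have hdeg : j = ∑ p ∈ s.toFinset, s.count p * p.natDegree := by
    rw [← hd, ← hprod, natDegree_multiset_prod _ (fun h => (hmem 0).1 h |>.1.ne_zero rfl),
      Finset.sum_multiset_map_count]
    simp
  have hle : ∀ p ∈ s.toFinset, s.count p * p.natDegree ≤ j := by
    intro p hp
    rw [hdeg]
    exact Finset.single_le_sum (f := fun p => s.count p * p.natDegree) (fun _ _ => Nat.zero_le _) hp
  conv_rhs => rw [hdeg]
  have h1 : ∀ i ∈ Finset.range (j + 1), ∑ p ∈ irrFin F i with p ^ (i / p.natDegree) ∣ f, p.natDegree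
      = ∑ p ∈ s.toFinset, if p.natDegree ∣ i ∧ p.natDegree ≤ i ∧ i / p.natDegree ≤ s.count p then p.natDegree else 0 := by
    intro i _
    rw [← Finset.sum_filter]
    refine Finset.sum_congr ?_ fun _ _ => rfl
    ext p
    simp only [Finset.mem_filter, mem_irrFin, Multiset.mem_toFinset, hmem]
    constructor
    · rintro ⟨⟨h1, h2, h3, h4⟩, h5⟩
      refine ⟨⟨h2, h1, (dvd_pow_self p ?_).trans h5⟩, h3, h4, (hcount p h2 h1 _).1 h5⟩
      exact (Nat.div_pos h4 h2.natDegree_pos).ne'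
    · rintro ⟨⟨h1, h2, h3⟩, h4, h5, h6⟩
      exact ⟨⟨h2, h1, h4, h5⟩, (hcount p h1 h2 _).2 h6⟩
  rw [Finset.sum_congr rfl h1, Finset.sum_comm]
  refine Finset.sum_congr rfl fun p hp => ?_
  have hpi := (hmem p).1 (Multiset.mem_toFinset.1 hp)
  have hpos := hpi.1.natDegree_pos
  rw [← Finset.sum_filter, Finset.sum_const, smul_eq_mul]
  congr 1
  have : (Finset.range (j + 1)).filter (fun i => p.natDegree ∣ i ∧ p.natDegree ≤ i ∧ i / p.natDegree ≤ s.count p)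
      = (Finset.Icc 1 (s.count p)).image (fun e => e * p.natDegree) := by
    ext i
    simp only [Finset.mem_filter, Finset.mem_range, Finset.mem_image, Finset.mem_Icc]
    constructor
    · rintro ⟨h1, ⟨e, rfl⟩, h3, h4⟩
      rw [Nat.mul_div_cancel_left _ hpos] at h4
      refine ⟨e, ⟨?_, h4⟩, mul_comm _ _⟩
      by_contra h
      have : e = 0 := by omega
      subst this; simp at h3; omega
    · rintro ⟨e, ⟨h1, h2⟩, rfl⟩
      rw [Nat.mul_div_cancel _ hpos]
      refine ⟨?_, dvd_mul_left _ _, Nat.le_mul_of_pos_left _ h1, h2⟩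
      have := hle p hp
      have := Nat.mul_le_mul_right p.natDegree h2
      omega
  rw [this, Finset.card_image_of_injective _ (mul_left_injective₀ hpos.ne')]
  simp

lemma aux_rec {F : Type*} [Field F] [Finite F] (ψ : F[X] →* ℂ) (j : ℕ) :
    (j : ℂ) * ∑ f ∈ monicFin F j, ψ f =
      ∑ x ∈ Finset.HasAntidiagonal.antidiagonal j, sumS ψ x.1 * ∑ f ∈ monicFin F x.2, ψ f := by
  classical
  rw [Finset.Nat.sum_antidiagonal_eq_sum_range_succ (fun a b => sumS ψ a * ∑ f ∈ monicFin F b, ψ f)]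
  have h1 : ∀ i ∈ Finset.range (j + 1), sumS ψ i * ∑ f ∈ monicFin F (j - i), ψ f =
      ∑ f ∈ monicFin F j, (∑ p ∈ irrFin F i with p ^ (i / p.natDegree) ∣ f, (p.natDegree : ℂ)) * ψ f := by
    intro i hi
    have hij : i ≤ j := by simpa [Nat.lt_succ_iff] using hi
    rw [sumS, Finset.sum_mul]
    simp_rw [Finset.sum_filter, Finset.sum_mul]
    rw [Finset.sum_comm]
    refine Finset.sum_congr rfl fun p hp => ?_
    obtain ⟨hm, hirr, hdvd, hle⟩ := mem_irrFin.1 hp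
    rw [mul_assoc, ← map_pow]
    set P := p ^ (i / p.natDegree) with hP
    have hPm : P.Monic := hm.pow _
    have hPd : P.natDegree = i := by rw [hP, hm.natDegree_pow, Nat.div_mul_cancel hdvd]
    simp_rw [ite_mul, zero_mul]
    rw [← Finset.sum_filter, ← Finset.mul_sum, Finset.mul_sum (monicFin F (j - i))]
    congr 1
    refine Finset.sum_bij (fun g _ => P * g) ?_ ?_ ?_ ?_
    · intro g hg
      obtain ⟨h1, h2⟩ := mem_monicFin.1 hg
      rw [Finset.mem_filter, mem_monicFin]
      refine ⟨⟨hPm.mul h1, ?_⟩, dvd_mul_right _ _⟩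
      rw [hPm.natDegree_mul h1, hPd, h2]; omega
    · intro g _ g' _ h
      exact mul_left_cancel₀ hPm.ne_zero h
    · intro f hf
      rw [Finset.mem_filter, mem_monicFin] at hf
      obtain ⟨⟨h1, h2⟩, g, rfl⟩ := hf
      have hgm : g.Monic := hPm.of_mul_monic_left h1
      refine ⟨g, mem_monicFin.2 ⟨hgm, ?_⟩, rfl⟩
      rw [hPm.natDegree_mul hgm, hPd] at h2
      omega
    · intro g _
      rw [map_mul]
  rw [Finset.sum_congr rfl h1, Finset.sum_comm, Finset.mul_sum]
  refine Finset.sum_congr rfl fun f hf => ?_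
  rw [← Finset.sum_mul]
  congr 1
  have := aux_mangoldt j f hf
  conv_lhs => rw [← this]
  push_cast
  rfl

/-- character as function on polynomials -/
noncomputable def psiHom {F E : Type*} [Field F] [Field E] [Algebra F E] (χ : MulChar E ℂ) (α : E) :
    F[X] →* ℂ := (χ.toMonoidHom).comp (aeval α : F[X] →ₐ[F] E).toRingHom.toMonoidHom

lemma psiHom_apply {F E : Type*} [Field F] [Field E] [Algebra F E] (χ : MulChar E ℂ) (α : E) (f : F[X]) :
    psiHom χ α f = χ (aeval α f) := rfl

lemma aux_vanish {F E : Type*} [Field F] [Finite F] [Field E] [Fintype E] [Algebra F E] (n : ℕ)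
    (hfin : Module.finrank F E = n)
    (α : E) (hα : (minpoly F α).natDegree = n) (χ : MulChar E ℂ) (hχ : χ ≠ 1) (j : ℕ) (hj : n ≤ j) :
    ∑ f ∈ monicFin F j, psiHom χ α f = 0 := by
  classical
  have hIntg : IsIntegral F α := Algebra.IsIntegral.isIntegral α
  have hsurj : ∀ e : E, ∃ h : F[X], h.degree < n ∧ aeval α h = e := by
    intro e
    have htop : IntermediateField.adjoin F {α} = ⊤ := by
      rw [Field.primitive_element_iff_minpoly_natDegree_eq, hα, hfin]
    have he : e ∈ IntermediateField.adjoin F {α} := by rw [htop]; trivial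
    rw [← IntermediateField.mem_toSubalgebra, IntermediateField.adjoin_simple_toSubalgebra_of_isAlgebraic hIntg.isAlgebraic,
      Algebra.adjoin_singleton_eq_range_aeval] at he
    obtain ⟨g, hg⟩ := he
    refine ⟨g %ₘ minpoly F α, ?_, ?_⟩
    · have := degree_modByMonic_lt g (minpoly.monic hIntg)
      rwa [degree_eq_natDegree (minpoly.ne_zero hIntg), hα] at this
    · have := modByMonic_add_div g (minpoly F α)
      rw [← hg]
      conv_rhs => rw [← this]
      simp
  choose h hhd hh using hsurj
  have key : ∀ e : E, ∑ f ∈ monicFin F j, psiHom χ α f = ∑ f ∈ monicFin F j, χ (aeval α f + e) := by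
    intro e
    have hlt : ∀ f ∈ monicFin F j, (h e).degree < f.degree := by
      intro f hf
      obtain ⟨h1, h2⟩ := mem_monicFin.1 hf
      rw [degree_eq_natDegree h1.ne_zero, h2]
      exact (hhd e).trans_le (by exact_mod_cast hj)
    symm
    refine Finset.sum_bij (fun f _ => f + h e) ?_ ?_ ?_ ?_
    · intro f hf
      obtain ⟨h1, h2⟩ := mem_monicFin.1 hf
      exact mem_monicFin.2 ⟨h1.add_of_left (hlt f hf), by rw [natDegree_add_eq_left_of_degree_lt (hlt f hf), h2]⟩
    · intro f _ f' _ hff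
      exact add_right_cancel hff
    · intro f hf
      obtain ⟨h1, h2⟩ := mem_monicFin.1 hf
      have hlt' : (-h e).degree < f.degree := by rw [degree_neg]; exact hlt f hf
      refine ⟨f + -h e, mem_monicFin.2 ⟨h1.add_of_left hlt', by rw [natDegree_add_eq_left_of_degree_lt hlt', h2]⟩, by simp⟩
    · intro f _
      rw [psiHom_apply, map_add (aeval α), hh]
  have hs : (Fintype.card E : ℂ) * ∑ f ∈ monicFin F j, psiHom χ α f = 0 := by
    rw [← nsmul_eq_mul, ← Finset.card_univ, ← Finset.sum_const, Finset.sum_congr rfl (fun e _ => key e), Finset.sum_comm]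
    refine Finset.sum_eq_zero fun f _ => ?_
    rw [← MulChar.sum_eq_zero_of_ne_one hχ]
    exact Fintype.sum_equiv (Equiv.addLeft (aeval α f)) _ _ (fun _ => rfl)
  rcases mul_eq_zero.1 hs with h | h
  · simp at h
  · exact h

lemma aux_indep {K ι : Type*} [Field K] [Fintype ι] (v : ι → ℕ) (hv : Function.Injective v)
    (g : ι → K[X]) (hg : ∀ i, (g i).coeff 0 ≠ 0) (u : ι → K) (hu : u ≠ 0) :
    ∑ i, C (u i) * (X ^ (v i) * g i) ≠ 0 := by
  classical
  obtain ⟨i0, hi0⟩ := Function.ne_iff.1 hu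
  obtain ⟨i, hi, hmin⟩ := Finset.exists_min_image (Finset.univ.filter fun i => u i ≠ 0) v
    ⟨i0, by simpa using hi0⟩
  simp only [Finset.mem_filter, Finset.mem_univ, true_and] at hi hmin
  intro h
  have h2 := congrArg (fun P : K[X] => P.coeff (v i)) h
  simp only [finsetSum_coeff, coeff_C_mul, coeff_X_pow_mul', coeff_zero] at h2
  rw [Finset.sum_eq_single i] at h2
  · simp [hi, hg i] at h2
  · intro j _ hj
    by_cases huj : u j = 0
    · simp [huj]
    · have h3 := hmin j huj
      have h4 : v i ≠ v j := fun h => hj (hv h.symm)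
      rw [if_neg (by omega), mul_zero]
  · simp

lemma stepanov {K : Type*} [Field K] [Fintype K] [DecidableEq K] (p μ B e r D : ℕ)
    [Fact p.Prime] [CharP K p] (hBp : B = p ^ μ)
    (hB : B = r * e + 1) (hK : Fintype.card K = B ^ 2) (hr : 1 ≤ r) (hD : 1 ≤ D)
    (he : r * D + r + D < e)
    (f : K[X]) (hf : ∃ f1 : K[X], f = X * f1 ∧ f1.coeff 0 ≠ 0) (hfD : f.natDegree ≤ D)
    (a : K) (ha : a ≠ 0) :
    (Finset.univ.filter fun t : K => f.eval t ^ (e * (B + 1)) = a).card ≤ e * B + (2 * D + 2) * B := by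
  obtain ⟨f1, rfl, hf1⟩ := hf
  have he2 : 2 < e := by omega
  set f : K[X] := X * f1 with hfdef
  set J := e + D + 1 with hJ
  set U := e - 1 with hU
  let ι := Fin (r * J) × Fin U
  let Tm : ι → K[X] := fun i =>
    C (a ^ (i.1.1 % r)) * (X ^ (i.2.1 * B + i.1.1 / r) * f ^ (e * (r - 1 - i.1.1 % r)))
  let N := (U - 1) * B + J + D * (e * (r - 1))
  have hNdiv : ∀ i : ι, i.1.1 / r < J := fun i => Nat.div_lt_of_lt_mul i.1.2
  have hTdeg : ∀ i, Tm i ∈ degreeLT K N := by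
    intro i
    rw [mem_degreeLT]
    refine lt_of_le_of_lt degree_le_natDegree ?_
    have h1 : (Tm i).natDegree ≤ i.2.1 * B + i.1.1 / r + (e * (r - 1 - i.1.1 % r)) * D := by
      refine (natDegree_C_mul_le _ _).trans (natDegree_mul_le.trans ?_)
      rw [natDegree_X_pow]
      gcongr
      exact natDegree_pow_le.trans (by gcongr)
    have h2 : i.2.1 * B ≤ (U - 1) * B := Nat.mul_le_mul_right _ (by have := i.2.2; omega)
    have h3 : (e * (r - 1 - i.1.1 % r)) * D ≤ D * (e * (r - 1)) := by
      rw [mul_comm]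
      exact Nat.mul_le_mul_left _ (Nat.mul_le_mul_left _ (Nat.sub_le _ _))
    have h4 := hNdiv i
    have : (Tm i).natDegree < N := by simp only [N]; omega
    exact_mod_cast this
  let L : (ι → K) →ₗ[K] degreeLT K N :=
    Fintype.linearCombination K (fun i => (⟨Tm i, hTdeg i⟩ : degreeLT K N))
  have hlt : Module.finrank K (degreeLT K N) < Module.finrank K (ι → K) := by
    rw [(degreeLTEquiv K N).finrank_eq, Module.finrank_fin_fun, Module.finrank_fintype_fun_eq_card]
    simp only [ι, Fintype.card_prod, Fintype.card_fin, N]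
    obtain ⟨x, rfl⟩ : ∃ x, r = x + 1 := ⟨r - 1, by omega⟩
    obtain ⟨y, rfl⟩ : ∃ y, e = y + 2 := ⟨e - 2, by omega⟩
    have : U = y + 1 := by omega
    rw [this, hJ, hB]
    simp only [Nat.add_sub_cancel]
    nlinarith
  have hker := LinearMap.ker_ne_bot_of_finrank_lt (f := L) hlt
  obtain ⟨w, hw, hw0⟩ := Submodule.exists_mem_ne_zero_of_ne_bot hker
  have hwT : ∑ i, C (w i) * Tm i = 0 := by
    have h := congrArg Subtype.val (LinearMap.mem_ker.1 hw)
    simpa [L, Fintype.linearCombination_apply, smul_eq_C_mul] using h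
  -- B-th roots
  have hsurj : Function.Surjective (fun x : K => x ^ B) := by
    have : Function.Injective (iterateFrobenius K p μ) := (iterateFrobenius K p μ).injective
    have h2 := Finite.injective_iff_surjective.1 this
    intro y; obtain ⟨x, hx⟩ := h2 y
    exact ⟨x, by rw [← hx, iterateFrobenius_def, hBp]⟩
  choose ρ hρ using hsurj
  simp only at hρ
  have hBpos : 0 < B := by omega
  let u : ι → K := fun i => ρ (w i)
  have hu : u ≠ 0 := by
    obtain ⟨i, hi⟩ := Function.ne_iff.1 hw0
    refine Function.ne_iff.2 ⟨i, fun h => hi ?_⟩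
    have := hρ (w i)
    simp only [u, Pi.zero_apply] at h
    rw [h, zero_pow hBpos.ne'] at this
    simpa using this.symm
  let G : K[X] := ∑ i : ι, C (u i) * (X ^ (i.2.1 + (i.1.1 / r) * B + e * (i.1.1 % r)) * f1 ^ (e * (i.1.1 % r)))
  have hG0 : G ≠ 0 := by
    refine aux_indep _ ?_ _ ?_ u hu
    · rintro ⟨⟨n1, hn1⟩, ⟨s1, hs1⟩⟩ ⟨⟨n2, hn2⟩, ⟨s2, hs2⟩⟩ h
      simp only at h
      have key : ∀ n s, s + (n / r) * B + e * (n % r) = e * n + n / r + s := by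
        intro n s
        conv_rhs => rw [← Nat.div_add_mod n r]
        rw [hB, Nat.mul_add_div hr, Nat.div_eq_of_lt (Nat.mod_lt n hr)]
        ring
      rw [key, key] at h
      have hnn : n1 = n2 := by
        rcases lt_trichotomy n1 n2 with h1 | h1 | h1
        · have := Nat.div_le_div_right (c := r) h1.le
          have : e * (n1 + 1) ≤ e * n2 := Nat.mul_le_mul_left _ h1
          rw [mul_add] at this
          omega
        · exact h1
        · have := Nat.div_le_div_right (c := r) h1.le
          have : e * (n2 + 1) ≤ e * n1 := Nat.mul_le_mul_left _ h1
          rw [mul_add] at this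
          omega
      subst hnn
      have : s1 = s2 := by omega
      subst this
      rfl
    · intro i
      rw [coeff_zero_eq_eval_zero, eval_pow]
      exact pow_ne_zero _ (by rwa [← coeff_zero_eq_eval_zero])
  have hG : G = ∑ i : ι, C (u i) * (X ^ (i.2.1 + (i.1.1 / r) * B) * f ^ (e * (i.1.1 % r))) := by
    refine Finset.sum_congr rfl fun i _ => ?_
    rw [hfdef, mul_pow, pow_add _ (i.2.1 + (i.1.1 / r) * B)]
    ring
  have hGdeg : G.natDegree ≤ e * B + (2 * D + 2) * B := by
    rw [hG]
    refine natDegree_sum_le_of_forall_le _ _ fun i _ => ?_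
    have h1 : (C (u i) * (X ^ (i.2.1 + (i.1.1 / r) * B) * f ^ (e * (i.1.1 % r)))).natDegree ≤
        (i.2.1 + (i.1.1 / r) * B) + (e * (i.1.1 % r)) * D := by
      refine (natDegree_C_mul_le _ _).trans (natDegree_mul_le.trans ?_)
      rw [natDegree_X_pow]
      gcongr
      exact natDegree_pow_le.trans (by gcongr)
    have h2 : (i.1.1 / r) * B ≤ (e + D) * B := Nat.mul_le_mul_right _ (by have := hNdiv i; omega)
    have h3 : e * (i.1.1 % r) ≤ B := by
      have := Nat.mod_lt i.1.1 hr
      have : e * (i.1.1 % r) ≤ e * r := Nat.mul_le_mul_left _ this.le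
      have h5 : e * r = r * e := mul_comm _ _
      omega
    have h3' := Nat.mul_le_mul_right D h3
    have h4 : i.2.1 ≤ B := by
      have := i.2.2
      have : e ≤ r * e := Nat.le_mul_of_pos_left _ hr
      omega
    nlinarith
  have hroots : (Finset.univ.filter fun t : K => f.eval t ^ (e * (B + 1)) = a) ⊆ G.roots.toFinset := by
    intro t ht
    simp only [Finset.mem_filter, Finset.mem_univ, true_and] at ht
    rw [Multiset.mem_toFinset, mem_roots hG0, IsRoot.def]
    have hft : f.eval t ≠ 0 := by
      intro h
      rw [h, zero_pow (Nat.mul_ne_zero (by omega) (by omega))] at ht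
      exact ha ht.symm
    have htQ : (t ^ B) ^ B = t := by
      rw [← pow_mul, ← sq, ← hK, FiniteField.pow_card]
    have hsum : (G.eval t) ^ B * f.eval t ^ (e * (r - 1)) = (∑ i, C (w i) * Tm i).eval t := by
      rw [hG, eval_finsetSum, eval_finsetSum, hBp, sum_pow_char_pow, Finset.sum_mul]
      refine Finset.sum_congr rfl fun i _ => ?_
      rw [← hBp]
      simp only [Tm, eval_mul, eval_C, eval_pow, eval_X]
      have hk : i.1.1 % r ≤ r - 1 := by have := Nat.mod_lt i.1.1 hr; omega
      obtain ⟨z, hz⟩ := Nat.exists_eq_add_of_le hk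
      rw [hz, Nat.add_sub_cancel_left, ← ht, ← hρ (w i)]
      generalize i.1.1 % r = k
      generalize i.1.1 / r = j
      generalize eval t f = y
      have e1 : ((t ^ (i.2.1 + j * B)) ^ B) = t ^ (i.2.1 * B + j) := by
        rw [pow_add, mul_pow, ← pow_mul, ← pow_mul t _ B,
          show j * B * B = B * B * j by ring, pow_mul t (B * B), pow_mul t B B, htQ, pow_add]
      rw [mul_pow, mul_pow, e1]
      simp only [u]
      ring
    rw [hwT, eval_zero, mul_eq_zero] at hsum
    rcases hsum with h | h
    · exact eq_zero_of_pow_eq_zero h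
    · exact absurd h (pow_ne_zero _ hft)
  calc _ ≤ G.roots.toFinset.card := Finset.card_le_card hroots
    _ ≤ Multiset.card G.roots := Multiset.toFinset_card_le _
    _ ≤ G.natDegree := card_roots' _
    _ ≤ _ := hGdeg

lemma aux_power_sum_bound {ι : Type*} [Fintype ι] (ω : ι → ℂ) (c R : ℝ) (hR : 0 < R) (N0 : ℕ)
    (h : ∀ N ≥ N0, ‖∑ i, ω i ^ N‖ ≤ c * R ^ N) (i0 : ι) : ‖ω i0‖ ≤ R := by
  classical
  set v := ω i0 with hv
  set P : ℂ[X] := ∏ z ∈ (Finset.univ.image ω).erase v, (X - C z) with hP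
  have hPv : P.eval v ≠ 0 := by
    rw [hP, eval_prod, Finset.prod_ne_zero_iff]
    intro z hz
    have := (Finset.mem_erase.1 hz).1
    simpa [sub_eq_zero] using this.symm
  have hPz : ∀ i, ω i ≠ v → P.eval (ω i) = 0 := by
    intro i hi
    rw [hP, eval_prod, Finset.prod_eq_zero_iff]
    exact ⟨ω i, by simp [hi], by simp⟩
  set m := (Finset.univ.filter fun i => ω i = v).card with hm
  have hm1 : 1 ≤ m := Finset.card_pos.2 ⟨i0, by simp [hv]⟩
  have key : ∀ N, (m : ℂ) * (P.eval v * v ^ N) =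
      ∑ j ∈ P.support, P.coeff j * ∑ i, ω i ^ (N + j) := by
    intro N
    have h1 : ∑ i, P.eval (ω i) * ω i ^ N = (m : ℂ) * (P.eval v * v ^ N) := by
      rw [hm, ← nsmul_eq_mul, ← Finset.sum_const, Finset.sum_filter]
      refine Finset.sum_congr rfl fun i _ => ?_
      split_ifs with hi
      · rw [hi]
      · rw [hPz i hi, zero_mul]
    rw [← h1]
    simp_rw [Finset.mul_sum]
    rw [Finset.sum_comm]
    refine Finset.sum_congr rfl fun i _ => ?_
    rw [eval_eq_sum, Polynomial.sum, Finset.sum_mul]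
    refine Finset.sum_congr rfl fun j _ => ?_
    rw [pow_add]; ring
  set c' := (∑ j ∈ P.support, ‖P.coeff j‖ * (|c| * R ^ j)) / ‖P.eval v‖ with hc'
  have bound : ∀ N ≥ N0, ‖v‖ ^ N ≤ c' * R ^ N := by
    intro N hN
    have hpos : 0 < ‖P.eval v‖ := norm_pos_iff.2 hPv
    rw [hc', div_mul_eq_mul_div, le_div_iff₀ hpos]
    have h2 := congrArg norm (key N)
    rw [norm_mul, norm_mul, norm_pow, Complex.norm_natCast] at h2
    have hm1' : (1 : ℝ) ≤ m := by exact_mod_cast hm1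
    calc ‖v‖ ^ N * ‖P.eval v‖ ≤ m * (‖P.eval v‖ * ‖v‖ ^ N) := by
          rw [mul_comm]; exact le_mul_of_one_le_left (by positivity) hm1'
      _ ≤ _ := by
          rw [h2, Finset.sum_mul]
          refine (norm_sum_le _ _).trans (Finset.sum_le_sum fun j _ => ?_)
          rw [norm_mul, mul_assoc]
          gcongr
          refine (h _ (by omega)).trans ?_
          rw [pow_add, mul_assoc, mul_comm (R ^ N)]
          gcongr
          exact le_abs_self c
  by_contra hlt
  push Not at hlt
  have h1 : 1 < ‖v‖ / R := (one_lt_div hR).2 hlt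
  obtain ⟨N, hN⟩ := pow_unbounded_of_one_lt c' h1
  have h2 := bound (max N N0) (le_max_right _ _)
  have h3 : (‖v‖ / R) ^ N ≤ (‖v‖ / R) ^ (max N N0) := pow_le_pow_right₀ h1.le (le_max_left _ _)
  have h4 : (‖v‖ / R) ^ (max N N0) ≤ c' := by
    rw [div_pow, div_le_iff₀ (by positivity)]; exact h2
  linarith

lemma aux_logderiv (s : Multiset ℂ) :
    PowerSeries.X * PowerSeries.derivative ℂ ((s.map fun z => (1 - PowerSeries.C z * PowerSeries.X : PowerSeries ℂ)).prod) =
    (s.map fun z => (1 - PowerSeries.C z * PowerSeries.X : PowerSeries ℂ)).prod *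
      PowerSeries.mk (fun i => if i = 0 then 0 else -(s.map (· ^ i)).sum) := by
  induction s using Multiset.induction with
  | empty =>
    have : (PowerSeries.mk fun i => if i = 0 then (0 : ℂ) else -((0 : Multiset ℂ).map (· ^ i)).sum) = 0 := by
      ext i; simp
    rw [this]
    have h1 : PowerSeries.derivative ℂ (1 : PowerSeries ℂ) = 0 := Derivation.map_one_eq_zero _
    simp [h1]
  | cons z s ih =>
    set L := (s.map fun z => (1 - PowerSeries.C z * PowerSeries.X : PowerSeries ℂ)).prod with hL
    set T := PowerSeries.mk (fun i => if i = 0 then (0 : ℂ) else -(s.map (· ^ i)).sum) with hT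
    set Z := PowerSeries.mk (fun i => if i = 0 then (0 : ℂ) else - z ^ i) with hZ
    have e1 : PowerSeries.mk (fun i => if i = 0 then (0 : ℂ) else -((z ::ₘ s).map (· ^ i)).sum) = Z + T := by
      ext i; by_cases hi : i = 0 <;> simp [hZ, hT, hi]; ring
    have e2 : (1 - PowerSeries.C z * PowerSeries.X) * Z = - (PowerSeries.C z * PowerSeries.X) := by
      ext i
      rw [sub_mul, one_mul, mul_assoc, map_sub, PowerSeries.coeff_C_mul]
      rcases i with _ | _ | i
      · simp [hZ]
      · rw [zero_add, PowerSeries.coeff_succ_X_mul 0 Z]; simp [hZ]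
      · rw [PowerSeries.coeff_succ_X_mul (i+1) Z]; simp [hZ]; ring
    have e3 : PowerSeries.derivative ℂ (1 - PowerSeries.C z * PowerSeries.X) = - PowerSeries.C z := by
      ext i
      rw [PowerSeries.coeff_derivative]
      rcases i with _ | i
      · simp
      · simp [PowerSeries.coeff_one]
    rw [Multiset.map_cons, Multiset.prod_cons, ← hL, e1, Derivation.leibniz, e3]
    simp only [smul_eq_mul]
    linear_combination (1 - PowerSeries.C z * PowerSeries.X) * ih - L * e2

lemma aux_newton (n : ℕ) (hn : 1 ≤ n) (A S : ℕ → ℂ) (hA0 : A 0 = 1) (hA : ∀ j, n ≤ j → A j = 0)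
    (hrec : ∀ j : ℕ, (j : ℂ) * A j = ∑ x ∈ Finset.HasAntidiagonal.antidiagonal j, S x.1 * A x.2) :
    ∃ s : Multiset ℂ, Multiset.card s ≤ n - 1 ∧ ∀ i, i ≠ 0 → S i = -(s.map (· ^ i)).sum := by
  set L : ℂ[X] := ∑ j ∈ Finset.range n, C (A j) * X ^ j with hL
  have hLc : ∀ j, L.coeff j = A j := by
    intro j
    simp only [hL, finsetSum_coeff, coeff_C_mul, coeff_X_pow]
    by_cases hj : j < n
    · simp [hj]
    · simp [hj, hA j (by omega)]
  have hL0 : L ≠ 0 := fun h => by have := hLc 0; simp [h, hA0] at this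
  have hLd : L.natDegree ≤ n - 1 := by
    rw [natDegree_le_iff_coeff_eq_zero]
    intro j hj; rw [hLc, hA j (by omega)]
  have hroot0 : ∀ z ∈ L.roots, z ≠ 0 := by
    rintro z hz rfl
    rw [mem_roots hL0, IsRoot.def, ← coeff_zero_eq_eval_zero, hLc, hA0] at hz
    exact one_ne_zero hz
  refine ⟨L.roots.map (·⁻¹), ?_, ?_⟩
  · rw [Multiset.card_map]; exact (card_roots' L).trans hLd
  have hfac : L = ((L.roots.map (·⁻¹)).map fun z => (1 - C z * X : ℂ[X])).prod := by
    have h1 : L = C L.leadingCoeff * (L.roots.map fun a => X - C a).prod :=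
      (IsAlgClosed.splits L).eq_prod_roots
    have h2 : (L.roots.map fun a => X - C a).prod =
        C ((L.roots.map fun a => -a).prod) * ((L.roots.map (·⁻¹)).map fun z => (1 - C z * X : ℂ[X])).prod := by
      rw [← Multiset.prod_hom _ C, Multiset.map_map, Multiset.map_map, ← Multiset.prod_map_mul]
      congr 1
      refine Multiset.map_congr rfl fun a ha => ?_
      have := hroot0 a ha
      simp only [Function.comp]
      rw [mul_sub, ← mul_assoc, ← C_mul]
      simp [this]
      ring
    have h3 : L = C (L.leadingCoeff * (L.roots.map fun a => -a).prod) * ((L.roots.map (·⁻¹)).map fun z => (1 - C z * X : ℂ[X])).prod := by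
      rw [C_mul, mul_assoc, ← h2]; exact h1
    have h4 : L.leadingCoeff * (L.roots.map fun a => -a).prod = 1 := by
      have h5 := congrArg (eval 0) h3
      rw [← coeff_zero_eq_eval_zero, hLc, hA0, eval_mul, eval_C, eval_multiset_prod, Multiset.map_map] at h5
      simp at h5
      simpa using h5.symm
    rw [h4, C_1, one_mul] at h3
    exact h3
  have hps : (L : PowerSeries ℂ) = ((L.roots.map (·⁻¹)).map fun z => (1 - PowerSeries.C z * PowerSeries.X : PowerSeries ℂ)).prod := by
    have h1 := congrArg (Polynomial.coeToPowerSeries.ringHom (R := ℂ)) hfac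
    rw [map_multiset_prod, Multiset.map_map] at h1
    rw [Polynomial.coeToPowerSeries.ringHom_apply] at h1
    rw [h1]
    congr 1
    refine Multiset.map_congr rfl fun a _ => ?_
    simp
  have hld := aux_logderiv (L.roots.map (·⁻¹))
  rw [← hps] at hld
  have hLS : PowerSeries.X * PowerSeries.derivative ℂ (L : PowerSeries ℂ) = (L : PowerSeries ℂ) * PowerSeries.mk S := by
    ext j
    rw [mul_comm (L : PowerSeries ℂ), PowerSeries.coeff_mul j (PowerSeries.mk S)]
    have hL' : ∀ l, PowerSeries.coeff l (L : PowerSeries ℂ) = A l := fun l => by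
      rw [Polynomial.coeff_coe, hLc]
    have hR : ∑ x ∈ Finset.HasAntidiagonal.antidiagonal j, PowerSeries.coeff x.1 (PowerSeries.mk S) *
        PowerSeries.coeff x.2 (L : PowerSeries ℂ) = (j : ℂ) * A j := by
      rw [hrec j]
      exact Finset.sum_congr rfl fun x _ => by rw [PowerSeries.coeff_mk, hL']
    rw [hR]
    rcases j with _ | j
    · simp
    · rw [PowerSeries.coeff_succ_X_mul j, PowerSeries.coeff_derivative, Polynomial.coeff_coe, hLc]
      push_cast; ring
  have hLne : (L : PowerSeries ℂ) ≠ 0 := by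
    intro h
    exact hL0 (Polynomial.coe_injective ℂ (by simpa using h))
  have hfin := mul_left_cancel₀ hLne (hLS.symm.trans hld)
  intro i hi
  have h6 := congrArg (PowerSeries.coeff i) hfin
  simpa [hi] using h6

lemma aux_prod_blocks {M : Type*} [CommMonoid M] (n k : ℕ) (h : ℕ → M) :
    ∏ i ∈ Finset.range (n * k), h i = ∏ l ∈ Finset.range k, ∏ j ∈ Finset.range n, h (n * l + j) := by
  induction k with
  | zero => simp
  | succ k ih => rw [mul_add, mul_one, Finset.prod_range_add, ih, Finset.prod_range_succ]

lemma aux_sub_pow (F : Type*) {K : Type*} [Field F] [Finite F] [Field K] [Algebra F K] (a b : K) (m : ℕ) :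
    (a - b) ^ (Nat.card F ^ m) = a ^ (Nat.card F ^ m) - b ^ (Nat.card F ^ m) := by
  have := Fintype.ofFinite F
  obtain ⟨p, hp⟩ := CharP.exists F
  have : Fact p.Prime := ⟨CharP.char_is_prime F p⟩
  have : CharP K p := charP_of_injective_algebraMap (algebraMap F K).injective p
  obtain ⟨s, -, hs⟩ := FiniteField.card F p
  rw [Nat.card_eq_fintype_card, hs, ← pow_mul, sub_pow_char_pow]

lemma aux_pow_eq_iff {F K : Type*} [Field F] [Finite F] [Field K] [Algebra F K] [FiniteDimensional F K]
    (x : K) (m : ℕ) : x ^ (Nat.card F ^ m) = x ↔ (minpoly F x).natDegree ∣ m := by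
  have hIntg : IsIntegral F x := Algebra.IsIntegral.isIntegral x
  rw [(minpoly.irreducible hIntg).natDegree_dvd_iff_dvd_X_pow_card_pow_sub_X, minpoly.dvd_iff]
  simp [sub_eq_zero]

lemma aux_minpoly_prod {F K : Type*} [Field F] [Finite F] [Field K] [Algebra F K] [FiniteDimensional F K]
    (x : K) : (minpoly F x).map (algebraMap F K) =
      ∏ i ∈ Finset.range (minpoly F x).natDegree, (X - C (x ^ (Nat.card F ^ i))) := by
  have hIntg : IsIntegral F x := Algebra.IsIntegral.isIntegral x
  set δ := (minpoly F x).natDegree with hδ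
  have hinj : ∀ m, Function.Injective (fun y : K => y ^ (Nat.card F ^ m)) := by
    intro m a b hab
    have h := aux_sub_pow F a b m
    simp only at hab
    rw [hab, sub_self] at h
    exact sub_eq_zero.1 (eq_zero_of_pow_eq_zero h)
  have hne : ∀ i j, i < j → j < δ → x ^ (Nat.card F ^ i) ≠ x ^ (Nat.card F ^ j) := by
    intro i j hij hj h
    obtain ⟨m, rfl⟩ := Nat.exists_eq_add_of_lt hij
    have h2 : x = x ^ (Nat.card F ^ (m + 1)) := by
      apply hinj i
      simp only
      rw [← pow_mul, ← pow_add, h]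
      congr 2; ring
    have h3 := (aux_pow_eq_iff (F := F) x (m + 1)).1 h2.symm
    have := Nat.le_of_dvd (by omega) h3
    omega
  have hroot : ∀ i, eval (x ^ (Nat.card F ^ i)) ((minpoly F x).map (algebraMap F K)) = 0 := by
    intro i
    rw [eval_map_algebraMap]
    induction i with
    | zero => simp
    | succ i ih =>
      have := Fintype.ofFinite F
      have h : x ^ (Nat.card F ^ (i + 1)) = FiniteField.frobeniusAlgHom F K (x ^ (Nat.card F ^ i)) := by
        rw [FiniteField.frobeniusAlgHom_apply, ← pow_mul, pow_succ, Nat.card_eq_fintype_card]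
      rw [h, aeval_algHom_apply, ih, map_zero]
  refine (eq_of_monic_of_dvd_of_natDegree_le (monic_prod_of_monic _ _ fun i _ => monic_X_sub_C _)
    ((minpoly.monic hIntg).map _) ?_ ?_)
  · refine Finset.prod_dvd_of_coprime ?_ ?_
    · intro i hi j hj hij
      simp only [Finset.coe_range, Set.mem_Iio] at hi hj
      refine isCoprime_X_sub_C_of_isUnit_sub (sub_ne_zero.2 ?_).isUnit
      rcases lt_or_gt_of_ne hij with h | h
      · exact hne i j h hj
      · exact (hne j i h hi).symm
    · intro i _
      exact dvd_iff_isRoot.2 (hroot i)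
  · rw [natDegree_map, natDegree_prod_of_monic _ _ fun i _ => monic_X_sub_C _]
    simp only [natDegree_X_sub_C]
    simp [hδ]

lemma aux_prod_eq {F K : Type*} [Field F] [Finite F] [Field K] [Algebra F K] [FiniteDimensional F K]
    (d : ℕ) (x a : K) (hd : (minpoly F x).natDegree ∣ d) :
    ∏ i ∈ Finset.range d, (a - x ^ (Nat.card F ^ i)) =
      (aeval a (minpoly F x)) ^ (d / (minpoly F x).natDegree) := by
  have hIntg : IsIntegral F x := Algebra.IsIntegral.isIntegral x
  have hpos : 0 < (minpoly F x).natDegree := minpoly.natDegree_pos hIntg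
  obtain ⟨k, rfl⟩ := hd
  rw [Nat.mul_div_cancel_left _ hpos, aux_prod_blocks]
  have h1 : aeval a (minpoly F x) = ∏ i ∈ Finset.range (minpoly F x).natDegree, (a - x ^ (Nat.card F ^ i)) := by
    rw [← eval_map_algebraMap, aux_minpoly_prod, eval_prod]
    simp
  rw [h1, ← Finset.card_range k, ← Finset.prod_const, Finset.card_range]
  refine Finset.prod_congr rfl fun l _ => Finset.prod_congr rfl fun j _ => ?_
  rw [pow_add, pow_mul x, (aux_pow_eq_iff (F := F) x _).2 (dvd_mul_right _ l)]

lemma aux_fiber {F K : Type*} [Field F] [Finite F] [Field K] [Fintype K] [Algebra F K]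
    (d : ℕ) (hd : Module.finrank F K = d) (φ : F[X] → ℂ) :
    ∑ x : K, φ (minpoly F x) = ∑ p ∈ irrFin F d, (p.natDegree : ℂ) * φ p := by
  classical
  have := Fintype.ofFinite F
  have hdpos : 0 < d := hd ▸ Module.finrank_pos
  have hIntg : ∀ x : K, IsIntegral F x := fun x => Algebra.IsIntegral.isIntegral x
  rw [← Finset.sum_fiberwise_of_maps_to (s := Finset.univ) (t := irrFin F d) (g := fun x : K => minpoly F x)]
  · refine Finset.sum_congr rfl fun p hp => ?_
    obtain ⟨hm, hirr, hdvd, hle⟩ := mem_irrFin.1 hp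
    rw [Finset.sum_congr rfl (g := fun _ => φ p)
      (fun x hx => by rw [(Finset.mem_filter.1 hx).2]), Finset.sum_const, nsmul_eq_mul]
    congr 2
    have hsep : p.Separable := PerfectField.separable_of_irreducible hirr
    have hsplit : (p.map (algebraMap F K)).Splits := by
      have h1 := (FiniteField.isSplittingField_sub K F).splits
      have h2 := hirr.natDegree_dvd_iff_dvd_X_pow_card_pow_sub_X.1 hdvd
      rw [← hd, ← Module.natCard_eq_pow_finrank, Nat.card_eq_fintype_card] at h2
      refine Splits.of_dvd h1 ?_ (Polynomial.map_dvd _ h2)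
      exact Polynomial.map_ne_zero (FiniteField.X_pow_card_sub_X_ne_zero F Fintype.one_lt_card)
    rw [← card_rootSet_eq_natDegree hsep hsplit, ← Set.toFinset_card]
    congr 1
    ext x
    simp only [Finset.mem_filter, Finset.mem_univ, true_and, Set.mem_toFinset, mem_rootSet]
    constructor
    · rintro rfl
      exact ⟨minpoly.ne_zero (hIntg x), minpoly.aeval F x⟩
    · rintro ⟨_, h⟩
      exact (minpoly.eq_of_irreducible_of_monic hirr h hm).symm
  · intro x _
    have h := minpoly.degree_dvd (K := F) (hIntg x)
    rw [hd] at h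
    exact mem_irrFin.2 ⟨minpoly.monic (hIntg x), minpoly.irreducible (hIntg x), h, Nat.le_of_dvd hdpos h⟩

lemma aux_weil_big {F E K : Type*} [Field F] [Finite F] [Field E] [Fintype E] [Field K] [Fintype K]
    [Algebra F E] [Algebra E K] [Algebra F K] [IsScalarTower F E K]
    (n μ q B e r D : ℕ) (hq : Nat.card F = q) (hFE : Module.finrank F E = n) (hEK : Module.finrank E K = 2 * μ)
    (hn : 1 < n) (hB : B = q ^ (n * μ)) (hr : r = q ^ n - 1) (hBe : B = r * e + 1)
    (hD : D = ∑ j ∈ Finset.range n, q ^ j) (he : r * D + r + D < e)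
    (α : E) (hα : (minpoly F α).natDegree = n) (χ : MulChar E ℂ) (hχ : χ ≠ 1) :
    ‖sumS (psiHom χ α : F[X] →* ℂ) (n * (2 * μ))‖ ≤ ((r * (2 * D + 2) + D : ℕ) : ℝ) * B := by
  classical
  have := Fintype.ofFinite F
  have hcE : Nat.card E = q ^ n := by rw [Module.natCard_eq_pow_finrank (K := F), hFE, hq]
  have hcK : Nat.card K = B ^ 2 := by
    rw [Module.natCard_eq_pow_finrank (K := E), hEK, hcE, hB, ← pow_mul, ← pow_mul]
    congr 1; ring
  have hFK : Module.finrank F K = n * (2 * μ) := by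
    rw [← Module.finrank_mul_finrank F E K, hFE, hEK]
  have hq1 : 1 < q := hq ▸ Finite.one_lt_card
  have hqn : 1 < q ^ n := Nat.one_lt_pow (by omega) hq1
  have hr1 : 1 ≤ r := by omega
  have hD1 : 1 ≤ D := by
    rw [hD]
    exact le_trans (by simp) (Finset.single_le_sum (f := fun j => q ^ j) (fun _ _ => Nat.zero_le _)
      (Finset.mem_range.2 (by omega : 0 < n)))
  set αK : K := algebraMap E K α with hαK
  have hαmin : (minpoly F αK).natDegree = n := by
    rw [hαK, minpoly.algebraMap_eq (algebraMap E K).injective, hα]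
  set f : K[X] := ∏ j ∈ Finset.range n, (C (αK - αK ^ (q ^ j)) - X ^ (q ^ j)) with hf
  have hfX : ∃ f1 : K[X], f = X * f1 ∧ f1.coeff 0 ≠ 0 := by
    obtain ⟨n', rfl⟩ : ∃ n', n = n' + 1 := ⟨n - 1, by omega⟩
    refine ⟨-∏ j ∈ Finset.range n', (C (αK - αK ^ (q ^ (j + 1))) - X ^ (q ^ (j + 1))), ?_, ?_⟩
    · rw [hf, Finset.prod_range_succ']
      simp
      ring
    · rw [coeff_neg, neg_ne_zero, coeff_zero_eq_eval_zero, eval_prod, Finset.prod_ne_zero_iff]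
      intro j hj
      rw [Finset.mem_range] at hj
      have : αK ^ (q ^ (j + 1)) ≠ αK := by
        intro h
        rw [← hq, aux_pow_eq_iff, hαmin] at h
        have := Nat.le_of_dvd (by omega) h
        omega
      rw [eval_sub, eval_C, eval_pow, eval_X, zero_pow (pow_ne_zero _ (by omega)), sub_zero]
      exact sub_ne_zero.2 this.symm
  have hfD : f.natDegree ≤ D := by
    rw [hf, hD]
    refine (natDegree_prod_le _ _).trans (Finset.sum_le_sum fun j _ => ?_)
    refine (natDegree_sub_le _ _).trans ?_
    rw [natDegree_C, natDegree_X_pow]; simp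
  have hc : ∑ l ∈ Finset.range (2 * μ), (q ^ n) ^ l = e * (B + 1) := by
    have h1 := Nat.geomSum_eq (m := q ^ n) (by omega) (2 * μ)
    have h2 : (q ^ n) ^ (2 * μ) = B * B := by
      rw [hB, ← pow_mul, ← pow_add]; congr 1; ring
    rw [h1, h2, ← hr]
    apply Nat.div_eq_of_eq_mul_right (by omega)
    have : B * B = r * (e * (B + 1)) + 1 := by rw [hBe]; ring
    omega
  have hdvd : ∀ x : K, (minpoly F x).natDegree ∣ n * (2 * μ) := fun x => by
    have h := minpoly.degree_dvd (K := F) (Algebra.IsIntegral.isIntegral x : IsIntegral F x)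
    rwa [hFK] at h
  let g : K → E := fun t => (aeval α (minpoly F (t + αK))) ^ ((n * (2 * μ)) / (minpoly F (t + αK)).natDegree)
  have hg : ∀ t, algebraMap E K (g t) = f.eval t ^ (e * (B + 1)) := by
    intro t
    simp only [g]
    rw [map_pow, ← aeval_algebraMap_apply, ← hαK, ← aux_prod_eq _ _ _ (hdvd _), aux_prod_blocks, ← hc,
      ← Finset.prod_pow_eq_pow_sum]
    refine Finset.prod_congr rfl fun l _ => ?_
    rw [hf, eval_prod, ← Finset.prod_pow]
    refine Finset.prod_congr rfl fun j _ => ?_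
    rw [eval_sub, eval_C, eval_pow, eval_X]
    have h1 : αK - αK ^ q ^ j - t ^ q ^ j = αK - (t + αK) ^ q ^ j := by
      have h2 := aux_sub_pow F (t + αK) αK j
      rw [add_sub_cancel_right, hq] at h2
      rw [h2]; ring
    rw [h1, ← pow_mul q, ← hq, aux_sub_pow F, (aux_pow_eq_iff (F := F) αK (n * l)).2 (by rw [hαmin]; exact dvd_mul_right _ _),
      ← pow_mul, ← pow_add, add_comm j]
  have hS : sumS (psiHom χ α : F[X] →* ℂ) (n * (2 * μ)) = ∑ t : K, χ (g t) := by
    rw [sumS, ← aux_fiber (K := K) (n * (2 * μ)) hFK (fun p => psiHom χ α p ^ ((n * (2 * μ)) / p.natDegree))]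
    rw [← Fintype.sum_equiv (Equiv.addRight αK) _ _ (fun _ => rfl)]
    refine Finset.sum_congr rfl fun t _ => ?_
    simp only [Equiv.coe_addRight, psiHom_apply, g, map_pow]
  let N : E → ℕ := fun a => (Finset.univ.filter fun t => g t = a).card
  set M := e * B + (2 * D + 2) * B with hM
  obtain ⟨p, hp⟩ := CharP.exists F
  have hpf : Fact p.Prime := ⟨CharP.char_is_prime F p⟩
  have hpK : CharP K p := charP_of_injective_algebraMap (algebraMap F K).injective p
  obtain ⟨s, -, hs⟩ := FiniteField.card F p
  have hNM : ∀ a, a ≠ 0 → N a ≤ M := by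
    intro a ha
    have h := stepanov p ((s : ℕ) * (n * μ)) B e r D (by rw [hB, ← hq, Nat.card_eq_fintype_card, hs, ← pow_mul]) hBe
      (by rw [← Nat.card_eq_fintype_card, hcK]) hr1 hD1 he f hfX hfD (algebraMap E K a)
      (by simpa using ha)
    refine le_trans (Finset.card_le_card ?_) h
    intro t ht
    simp only [Finset.mem_filter, Finset.mem_univ, true_and] at ht ⊢
    rw [← hg, ht]
  have hf0 : f ≠ 0 := by
    obtain ⟨f1, h1, h2⟩ := hfX
    rw [h1]
    refine mul_ne_zero X_ne_zero ?_
    rintro rfl; simp at h2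
  have hN0 : N 0 ≤ D := by
    refine le_trans (Finset.card_le_card (t := f.roots.toFinset) ?_)
      ((Multiset.toFinset_card_le _).trans ((card_roots' f).trans hfD))
    intro t ht
    simp only [Finset.mem_filter, Finset.mem_univ, true_and] at ht
    rw [Multiset.mem_toFinset, mem_roots hf0, IsRoot.def]
    have := hg t
    rw [ht, map_zero] at this
    exact eq_zero_of_pow_eq_zero this.symm
  have hNsum : ∑ a : E, N a = B ^ 2 := by
    rw [← hcK, Nat.card_eq_fintype_card, ← Finset.card_univ]
    exact (Finset.card_eq_sum_card_fiberwise (fun _ _ => Finset.mem_coe.2 (Finset.mem_univ _))).symm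
  have hS2 : ∑ t : K, χ (g t) = ∑ a : E, (N a : ℂ) * χ a := by
    rw [← Finset.sum_fiberwise_of_maps_to (s := Finset.univ) (t := (Finset.univ : Finset E)) (g := g)
      (fun _ _ => Finset.mem_univ _)]
    refine Finset.sum_congr rfl fun a _ => ?_
    rw [Finset.sum_congr rfl (g := fun _ => χ a)
      (fun x hx => by rw [(Finset.mem_filter.1 hx).2]), Finset.sum_const, nsmul_eq_mul]
  have hS3 : ∑ a : E, (N a : ℂ) * χ a = - ∑ a ∈ Finset.univ.erase (0 : E), ((M : ℂ) - N a) * χ a := by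
    have h1 : ∑ a : E, ((M : ℂ) - N a) * χ a = ∑ a ∈ Finset.univ.erase (0 : E), ((M : ℂ) - N a) * χ a := by
      have hz : χ 0 = 0 := MulChar.map_zero χ
      rw [← Finset.add_sum_erase _ _ (Finset.mem_univ (0 : E)), hz, mul_zero, zero_add]
    rw [← h1]
    simp_rw [sub_mul]
    rw [Finset.sum_sub_distrib, ← Finset.mul_sum, MulChar.sum_eq_zero_of_ne_one hχ]
    ring
  have hcard : (Finset.univ.erase (0 : E)).card = r := by
    rw [Finset.card_erase_of_mem (Finset.mem_univ _), Finset.card_univ, ← Nat.card_eq_fintype_card, hcE, hr]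
  rw [hS, hS2, hS3, norm_neg]
  have hb : ‖∑ a ∈ Finset.univ.erase (0 : E), ((M : ℂ) - N a) * χ a‖ ≤
      ∑ a ∈ Finset.univ.erase (0 : E), ((M : ℝ) - N a) := by
    refine (norm_sum_le _ _).trans (Finset.sum_le_sum fun a ha => ?_)
    have ha0 : a ≠ 0 := (Finset.mem_erase.1 ha).1
    rw [norm_mul]
    have h1 : ‖χ a‖ ≤ 1 := by
      have : χ a ^ (Fintype.card E - 1) = 1 := by
        rw [← map_pow, FiniteField.pow_card_sub_one_eq_one a ha0, map_one]
      have h2 : Fintype.card E - 1 ≠ 0 := by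
        rw [← Nat.card_eq_fintype_card, hcE]; omega
      exact (Complex.norm_eq_one_of_pow_eq_one this h2).le
    have h2 : ‖(M : ℂ) - N a‖ = (M : ℝ) - N a := by
      have h3 := hNM a ha0
      rw [← Nat.cast_sub h3, Complex.norm_natCast, Nat.cast_sub h3]
    rw [h2]
    have h4 : (0 : ℝ) ≤ (M : ℝ) - N a := by rw [← h2]; exact norm_nonneg _
    exact mul_le_of_le_one_right h4 h1
  refine hb.trans ?_
  rw [Finset.sum_sub_distrib, Finset.sum_const, hcard, nsmul_eq_mul]
  have h5 : (N 0 : ℝ) + ∑ a ∈ Finset.univ.erase (0 : E), (N a : ℝ) = (B : ℝ) ^ 2 := by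
    have := Finset.add_sum_erase Finset.univ N (Finset.mem_univ (0 : E))
    rw [hNsum] at this
    exact_mod_cast this
  have h6 : (N 0 : ℝ) ≤ D := by exact_mod_cast hN0
  have h7 : (B : ℝ) = r * e + 1 := by exact_mod_cast hBe
  have h8 : (1 : ℝ) ≤ B := by rw [h7]; nlinarith [Nat.cast_nonneg (α := ℝ) r, Nat.cast_nonneg (α := ℝ) e]
  have h9 : (M : ℝ) = e * B + (2 * D + 2) * B := by rw [hM]; push_cast; ring
  have h10 : (0 : ℝ) ≤ D := Nat.cast_nonneg D
  push_cast
  rw [h9]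
  have h11 : (r : ℝ) * (e * B) = B ^ 2 - B := by
    have : (r : ℝ) * e = B - 1 := by linarith
    rw [← mul_assoc, this]; ring
  nlinarith

lemma aux_weil {F E : Type*} [Field F] [Finite F] [Field E] [Fintype E] [Algebra F E]
    (q n : ℕ) (hq : Nat.card F = q) (hFE : Module.finrank F E = n) (hn : 1 < n)
    (α : E) (hα : (minpoly F α).natDegree = n) (χ : MulChar E ℂ) (hχ : χ ≠ 1) (d : ℕ) (hd : 1 ≤ d) :
    ‖sumS (psiHom χ α : F[X] →* ℂ) d‖ ≤ ((n - 1 : ℕ) : ℝ) * (Real.sqrt q) ^ d := by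
  classical
  have hq1 : 1 < q := hq ▸ Finite.one_lt_card
  have hqn : 1 < q ^ n := Nat.one_lt_pow (by omega) hq1
  obtain ⟨s, hs, hsum⟩ := aux_newton n (by omega) (fun j => ∑ f ∈ monicFin F j, psiHom χ α f)
    (sumS (psiHom χ α : F[X] →* ℂ))
    (by
      have : monicFin F 0 = {1} := by
        ext f
        rw [mem_monicFin, Finset.mem_singleton]
        constructor
        · rintro ⟨h1, h2⟩; exact h1.natDegree_eq_zero.1 h2
        · rintro rfl; exact ⟨monic_one, natDegree_one⟩
      rw [this, Finset.sum_singleton, map_one])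
    (fun j hj => aux_vanish n hFE α hα χ hχ j hj)
    (fun j => aux_rec _ j)
  set D := ∑ j ∈ Finset.range n, q ^ j with hD
  set r := q ^ n - 1 with hr
  obtain ⟨p, hp⟩ := CharP.exists E
  have hpf : Fact p.Prime := ⟨CharP.char_is_prime E p⟩
  have hbig : ∀ μ ≥ r * D + r + D + 1, ‖sumS (psiHom χ α : F[X] →* ℂ) (n * (2 * μ))‖ ≤
      ((r * (2 * D + 2) + D : ℕ) : ℝ) * ((q : ℝ) ^ n) ^ μ := by
    intro μ hμ
    have hne : NeZero (2 * μ) := ⟨by omega⟩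
    let K := FiniteField.Extension E p (2 * μ)
    let _ : Algebra F K := ((algebraMap E K).comp (algebraMap F E)).toAlgebra
    have : IsScalarTower F E K := IsScalarTower.of_algebraMap_eq (fun _ => rfl)
    let _ : Fintype K := @Fintype.ofFinite K (Module.finite_of_finite E)
    have hgeo := Nat.geomSum_eq (m := q ^ n) (by omega) μ
    have hgeo2 : r * (∑ l ∈ Finset.range μ, (q ^ n) ^ l) + 1 = q ^ (n * μ) := by
      have h := Nat.geomSum_eq (m := q ^ n) (by omega) μ
      have h2 : (q ^ n - 1) ∣ (q ^ n) ^ μ - 1 := by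
        simpa using Nat.sub_dvd_pow_sub_pow (q ^ n) 1 μ
      rw [h, hr, Nat.mul_div_cancel' h2, pow_mul]
      have : 0 < (q ^ n) ^ μ := by positivity
      omega
    have h := aux_weil_big (F := F) (E := E) (K := K) n μ q (q ^ (n * μ))
      (∑ l ∈ Finset.range μ, (q ^ n) ^ l) r D hq hFE (FiniteField.finrank_extension E p (2 * μ)) hn rfl hr
      hgeo2.symm hD ?_ α hα χ hχ
    · refine h.trans_eq ?_
      rw [← pow_mul]; push_cast; ring
    · have : ∑ l ∈ Finset.range μ, 1 ≤ ∑ l ∈ Finset.range μ, (q ^ n) ^ l :=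
        Finset.sum_le_sum fun l _ => Nat.one_le_pow _ _ (by omega)
      simp at this
      omega
  have hω : ∀ z ∈ s, ‖z‖ ≤ Real.sqrt q := by
    intro z hz
    have hz' : z ∈ s.toList := Multiset.mem_toList.2 hz
    obtain ⟨i0, hi0, hzi⟩ := List.mem_iff_getElem.1 hz'
    have h := aux_power_sum_bound (ι := Fin s.toList.length) (fun i => (s.toList[i]) ^ (2 * n))
      ((r * (2 * D + 2) + D : ℕ) : ℝ) ((q : ℝ) ^ n) (by positivity) (r * D + r + D + 1)
      (by
        intro N hN
        have h1 := hbig N hN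
        rw [hsum _ (mul_ne_zero (by omega) (by omega)), norm_neg] at h1
        have h2 : (s.map (· ^ (n * (2 * N)))).sum =
            ∑ i : Fin s.toList.length, ((s.toList[i]) ^ (2 * n)) ^ N := by
          have h3 : (s.map (· ^ (n * (2 * N)))).sum = (s.toList.map (· ^ (n * (2 * N)))).sum := by
            conv_lhs => rw [← Multiset.coe_toList s]
            rw [Multiset.map_coe, Multiset.sum_coe]
          rw [h3, ← Fin.sum_univ_fun_getElem]
          refine Finset.sum_congr rfl fun i _ => ?_
          rw [← pow_mul]; congr 1; ring
        rwa [h2] at h1) ⟨i0, hi0⟩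
    simp only [Fin.getElem_fin, hzi, norm_pow] at h
    rw [pow_mul] at h
    have h2 : ‖z‖ ^ 2 ≤ q := le_of_pow_le_pow_left₀ (by omega) (by positivity) h
    exact Real.le_sqrt_of_sq_le h2
  rw [hsum d (by omega), norm_neg]
  have h1 : ‖(s.map (· ^ d)).sum‖ ≤ (s.map (fun z => ‖z ^ d‖)).sum := by
    have := norm_multiset_sum_le (s.map (· ^ d))
    rwa [Multiset.map_map] at this
  refine h1.trans ?_
  have h2 : (s.map (fun z => ‖z ^ d‖)).sum ≤ (s.map (fun z => ‖z ^ d‖)).card • (Real.sqrt q) ^ d := by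
    refine Multiset.sum_le_card_nsmul _ _ ?_
    intro x hx
    obtain ⟨z, hz, rfl⟩ := Multiset.mem_map.1 hx
    rw [norm_pow]
    exact pow_le_pow_left₀ (norm_nonneg _) (hω z hz) d
  refine h2.trans ?_
  rw [Multiset.card_map, nsmul_eq_mul]
  gcongr

lemma aux_trivial {F : Type*} [Field F] [Finite F] (q d : ℕ) (hq : Nat.card F = q) (hd : 1 ≤ d) :
    ∑ p ∈ irrFin F d, (p.natDegree : ℂ) = (q : ℂ) ^ d := by
  obtain ⟨p, hp⟩ := CharP.exists F
  have hpf : Fact p.Prime := ⟨CharP.char_is_prime F p⟩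
  have hne : NeZero d := ⟨by omega⟩
  let K := FiniteField.Extension F p d
  let _ : Fintype K := @Fintype.ofFinite K (Module.finite_of_finite F)
  have h := aux_fiber (F := F) (K := K) d (FiniteField.finrank_extension F p d) (fun _ => 1)
  simp only [mul_one] at h
  rw [← h, Finset.sum_const, Finset.card_univ, ← Nat.card_eq_fintype_card,
    FiniteField.natCard_extension, hq]
  simp

lemma aux_orth {E : Type*} [Field E] [Fintype E] [Fintype (MulChar E ℂ)] (a : E) (ha : a ≠ 1) :
    ∑ χ : MulChar E ℂ, χ a = 0 := by
  obtain ⟨χ, hχ⟩ := MulChar.exists_apply_ne_one_of_hasEnoughRootsOfUnity E ℂ ha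
  refine eq_zero_of_mul_eq_self_left hχ ?_
  simp only [Finset.mul_sum, ← MulChar.mul_apply]
  exact Fintype.sum_bijective _ (Group.mulLeft_bijective χ) _ _ fun χ' ↦ rfl

/-- If `q^{kd} ≥ q^{2n}(n-1)^{2k}` then every `β ∈ 𝔽_{q^n}^×` is a product of
exactly `k` elements of `E_d`. -/
theorem product_of_exactly_k
    {F E : Type*} [Field F] [Fintype F] [Field E] [Fintype E] [Algebra F E]
    (q n d k : ℕ) (hq : IsPrimePow q)
    (hcardF : Fintype.card F = q) (hcardE : Fintype.card E = q ^ n)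
    (hn : 1 < n) (hd : 1 ≤ d) (hdn : d < n) (hk : 1 ≤ k)
    (hcond : q ^ (2 * n) * (n - 1) ^ (2 * k) ≤ q ^ (k * d))
    (α : E) (hα : (minpoly F α).natDegree = n) :
    ∀ β : Eˣ, ∃ g : Fin k → Polynomial F, (∀ i, g i ∈ primarySet F d) ∧
      (β : E) = ∏ i, Polynomial.aeval α (g i) := by
  classical
  intro β
  by_contra hno
  have hq1 : 1 < q := hq.one_lt
  have hqF : Nat.card F = q := by rw [Nat.card_eq_fintype_card, hcardF]
  have hFE : Module.finrank F E = n := by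
    have h := Module.card_eq_pow_finrank (K := F) (V := E)
    rw [hcardE, hcardF] at h
    exact (Nat.pow_right_injective hq1 h).symm
  letI : Fintype (MulChar E ℂ) := Fintype.ofFinite _
  have hne : ∀ p ∈ irrFin F d, aeval α p ≠ 0 := by
    intro p hp h0
    obtain ⟨hm, hirr, hdvd, hle⟩ := mem_irrFin.1 hp
    have := natDegree_le_of_dvd (minpoly.dvd F α h0) hm.ne_zero
    omega
  -- vanishing of the character sum
  have hvan : ∑ χ : MulChar E ℂ, χ ((β⁻¹ : Eˣ) : E) * (sumS (psiHom χ α : F[X] →* ℂ) d) ^ k = 0 := by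
    have h1 : ∀ χ : MulChar E ℂ, χ ((β⁻¹ : Eˣ) : E) * (sumS (psiHom χ α : F[X] →* ℂ) d) ^ k =
        ∑ f ∈ Fintype.piFinset (fun _ : Fin k => irrFin F d),
          (∏ i, ((f i).natDegree : ℂ)) *
            χ (((β⁻¹ : Eˣ) : E) * ∏ i, aeval α ((f i) ^ (d / (f i).natDegree))) := by
      intro χ
      have h2 : (sumS (psiHom χ α : F[X] →* ℂ) d) ^ k =
          ∏ _i : Fin k, sumS (psiHom χ α : F[X] →* ℂ) d := by
        rw [Finset.prod_const, Finset.card_univ, Fintype.card_fin]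
      rw [h2]
      simp only [sumS]
      rw [Finset.prod_univ_sum, Finset.mul_sum]
      refine Finset.sum_congr rfl fun f _ => ?_
      rw [Finset.prod_mul_distrib, map_mul, map_prod]
      simp only [psiHom_apply, map_pow]
      ring
    rw [Finset.sum_congr rfl (fun χ _ => h1 χ), Finset.sum_comm]
    refine Finset.sum_eq_zero fun f hf => ?_
    rw [← Finset.mul_sum, aux_orth, mul_zero]
    intro h
    apply hno
    refine ⟨fun i => (f i) ^ (d / (f i).natDegree), ?_, ?_⟩
    · intro i
      obtain ⟨hm, hirr, hdvd, hle⟩ := mem_irrFin.1 (Fintype.mem_piFinset.1 hf i)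
      refine ⟨hm.pow _, ?_, f i, hm, hirr, _, Nat.div_pos hle hirr.natDegree_pos, rfl⟩
      rw [hm.natDegree_pow, Nat.div_mul_cancel hdvd]
    · have := congrArg (fun x => (β : E) * x) h
      simpa using this.symm
  have hone : sumS (psiHom (1 : MulChar E ℂ) α : F[X] →* ℂ) d = (q : ℂ) ^ d := by
    rw [← aux_trivial q d hqF hd, sumS]
    refine Finset.sum_congr rfl fun p hp => ?_
    rw [psiHom_apply, MulChar.one_apply (hne p hp).isUnit, one_pow, mul_one]
  rw [← Finset.add_sum_erase _ _ (Finset.mem_univ (1 : MulChar E ℂ)), hone,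
    MulChar.one_apply (Units.isUnit _), one_mul] at hvan
  set Y : ℝ := (((n - 1 : ℕ) : ℝ) * (Real.sqrt q) ^ d) ^ k with hY
  have hcardX : ((Finset.univ : Finset (MulChar E ℂ)).erase 1).card = q ^ n - 1 - 1 := by
    rw [Finset.card_erase_of_mem (Finset.mem_univ _), Finset.card_univ, ← Nat.card_eq_fintype_card,
      MulChar.card_eq_card_units_of_hasEnoughRootsOfUnity, Nat.card_eq_fintype_card,
      Fintype.card_units, hcardE]
  have hbound : ((q : ℝ) ^ d) ^ k ≤ ((q ^ n - 1 - 1 : ℕ) : ℝ) * Y := by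
    have h1 := eq_neg_of_add_eq_zero_left hvan
    have h2 : ‖((q : ℂ) ^ d) ^ k‖ = ((q : ℝ) ^ d) ^ k := by simp
    rw [← h2, h1, norm_neg, ← hcardX, ← nsmul_eq_mul]
    refine (norm_sum_le _ _).trans (Finset.sum_le_card_nsmul _ _ _ fun χ hχ => ?_)
    rw [norm_mul, norm_pow]
    have h3 : ‖χ ((β⁻¹ : Eˣ) : E)‖ ≤ 1 := by
      have h4 : χ ((β⁻¹ : Eˣ) : E) ^ (Fintype.card E - 1) = 1 := by
        rw [← map_pow, FiniteField.pow_card_sub_one_eq_one _ (Units.ne_zero _), map_one]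
      have h5 : Fintype.card E - 1 ≠ 0 := by
        have := Nat.one_lt_pow (n := n) (by omega) hq1
        omega
      exact (Complex.norm_eq_one_of_pow_eq_one h4 h5).le
    have h6 := aux_weil q n hqF hFE hn α hα χ (Finset.mem_erase.1 hχ).1 d hd
    have h7 := pow_le_pow_left₀ (norm_nonneg _) h6 k
    exact (mul_le_of_le_one_left (by positivity) h3).trans h7
  set W : ℝ := (Real.sqrt q) ^ (k * d) with hW
  have hsq : Real.sqrt q ^ 2 = q := Real.sq_sqrt (Nat.cast_nonneg q)
  have hsq0 : 0 < Real.sqrt q := Real.sqrt_pos.2 (by exact_mod_cast (by omega : 0 < q))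
  have hWpos : 0 < W := by positivity
  have hW2 : W ^ 2 = (q : ℝ) ^ (k * d) := by rw [hW, ← pow_mul, mul_comm, pow_mul, hsq]
  have hYW : Y = ((n - 1 : ℕ) : ℝ) ^ k * W := by rw [hY, mul_pow, ← pow_mul, hW, mul_comm k d]
  have hn1 : (0 : ℝ) < ((n - 1 : ℕ) : ℝ) ^ k := by
    have : (0 : ℝ) < ((n - 1 : ℕ) : ℝ) := by exact_mod_cast (by omega : 0 < n - 1)
    positivity
  have hlt : ((q ^ n - 1 - 1 : ℕ) : ℝ) < (q : ℝ) ^ n := by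
    have : q ^ n - 1 - 1 < q ^ n := by
      have := Nat.one_lt_pow (n := n) (by omega) hq1
      omega
    exact_mod_cast this
  have hlow : (q : ℝ) ^ n * ((n - 1 : ℕ) : ℝ) ^ k ≤ W := by
    apply le_of_sq_le_sq _ hWpos.le
    rw [hW2, mul_pow, ← pow_mul, ← pow_mul, mul_comm n, mul_comm k 2]
    exact_mod_cast hcond
  rw [← pow_mul, mul_comm d k, ← hW2, hYW] at hbound
  have h8 : W * W ≤ (((q ^ n - 1 - 1 : ℕ) : ℝ) * ((n - 1 : ℕ) : ℝ) ^ k) * W := by nlinarith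
  have h9 := le_of_mul_le_mul_right h8 hWpos
  have h10 := mul_lt_mul_of_pos_right hlt hn1
  linarith
end

section
/- Let q be a prime power, n > 1 and 1 ≤ d < n integers, and α ∈ 𝔽_{q^n} of degree n over 𝔽_q. For every integer k ≥ 1 and every β ∈ 𝔽_{q^n}^×, the weighted count M_k(β) = Σ Λ(g₁)···Λ(g_k), where the sum is over all k-tuples (g₁, …, g_k) ∈ P_d^k with g₁(α)···g_k(α) = β, satisfies |M_k(β) − q^{kd}/(q^n − 1)| < (n−1)^k · q^{kd/2}. -/
open Polynomial

/-- `Lam g` is the von Mangoldt function: for a primary polynomial `g = p^e`,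
the degree of its unique monic irreducible factor `p`; `0` otherwise. -/
noncomputable def Lam {F : Type*} [Field F] (g : Polynomial F) : ℕ :=
  haveI := Classical.propDecidable (IsPrimaryPoly g)
  if h : IsPrimaryPoly g then h.choose.natDegree else 0

theorem exists_lin_rel {K : Type*} [Field K] {ι : Type*} [Fintype ι] (P : ι → K[X]) (N : ℕ)
    (hP : ∀ t, (P t).natDegree < N) (hN : N < Fintype.card ι) :
    ∃ b : ι → K, (∃ t, b t ≠ 0) ∧ ∑ t, C (b t) * P t = 0 := by
  classical
  let v : ι → (Fin N → K) := fun t i => (P t).coeff i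
  have hv : ¬ LinearIndependent K v := by
    intro h
    have := h.fintype_card_le_finrank
    simp at this
    omega
  rw [Fintype.not_linearIndependent_iff] at hv
  obtain ⟨b, hb, hne⟩ := hv
  refine ⟨b, hne, ?_⟩
  ext i
  simp only [finsetSum_coeff, coeff_C_mul, coeff_zero]
  by_cases hi : i < N
  · have := congrFun hb ⟨i, hi⟩
    simpa [v] using this
  · apply Finset.sum_eq_zero
    intro t _
    rw [coeff_eq_zero_of_natDegree_lt (by have := hP t; omega), mul_zero]

theorem sum_ne_zero_of_orders {K : Type*} [Field K] {ι : Type*} [Fintype ι]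
    (b : ι → K) (o : ι → ℕ) (ho : Function.Injective o) (u : ι → K[X])
    (hu : ∀ t, (u t).eval 0 ≠ 0) (hb : ∃ t, b t ≠ 0) :
    ∑ t, C (b t) * (X ^ o t * u t) ≠ 0 := by
  classical
  obtain ⟨t0, ht0, hmin⟩ := Finset.exists_min_image (Finset.univ.filter fun t => b t ≠ 0) o
    (by obtain ⟨t, ht⟩ := hb; exact ⟨t, by simpa using ht⟩)
  intro h
  have h1 := congrArg (fun p => coeff p (o t0)) h
  simp only [finsetSum_coeff, coeff_C_mul, coeff_zero] at h1
  rw [Finset.sum_eq_single t0] at h1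
  · rw [mul_comm (X ^ _), coeff_mul_X_pow', if_pos le_rfl, Nat.sub_self, coeff_zero_eq_eval_zero] at h1
    have h2 : b t0 ≠ 0 := by simpa using ht0
    exact (mul_ne_zero h2 (hu t0)) h1
  · intro t _ hne
    by_cases hbt : b t = 0
    · simp [hbt]
    · have h3 := hmin t (by simpa using hbt)
      have h4 : o t ≠ o t0 := fun h => hne (ho h)
      rw [mul_comm (X ^ _), coeff_mul_X_pow', if_neg (by omega), mul_zero]
  · simp

theorem stepanov_s3 {K : Type*} [Field K] [Fintype K] [DecidableEq K] (p e s m c D : ℕ)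
    [Fact p.Prime] [CharP K p] (hsp : s = p ^ e) (hs : Fintype.card K = s ^ 2)
    (hsm : s = m * c + 1) (hm : 1 ≤ m) (f : K[X])
    (h0 : f.eval 0 ≠ 0) (hD : f.natDegree + 1 ≤ D) (ζ : K) (hζ : ζ ≠ 0) (hbig : 2 * D + 6 ≤ s) :
    m * (Finset.univ.filter fun x : K => (x * f.eval x) ^ (c * (s + 1)) = ζ).card
      ≤ s ^ 2 + m * (2 * D + 4) * s := by
  have hc : 1 ≤ c := by
    rcases Nat.eq_zero_or_pos c with h | h
    · subst h; omega
    · exact h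
  set B := c + D + 3 with hB
  set g : K[X] := (X * f) ^ c with hg
  have hgdeg : g.natDegree ≤ c * D := by
    rw [hg]
    refine natDegree_pow_le.trans ?_
    gcongr
    refine natDegree_mul_le.trans ?_
    simp; omega
  have hcs : c * m = s - 1 := by rw [hsm, mul_comm]; omega
  have hcles : c < s := by nlinarith
  -- the auxiliary relation
  obtain ⟨b, hbne, hb⟩ := exists_lin_rel (ι := Fin c × Fin m × Fin B)
    (fun t => C (ζ ^ (t.2.1 : ℕ)) * (X ^ (s * t.1 + t.2.2) * g ^ (m - 1 - t.2.1)))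
    (s * c + s * D + B) (by
      rintro ⟨i, j, k⟩
      refine lt_of_le_of_lt (natDegree_C_mul_le _ _) ?_
      refine lt_of_le_of_lt natDegree_mul_le ?_
      have h1 : (g ^ (m - 1 - (j : ℕ))).natDegree ≤ s * D := by
        refine natDegree_pow_le.trans ?_
        calc (m - 1 - (j : ℕ)) * g.natDegree ≤ m * (c * D) := by gcongr; omega
          _ = (m * c) * D := by ring
          _ ≤ s * D := by gcongr; omega
      have h2 : s * (i : ℕ) ≤ s * c := by gcongr; omega
      have h3 := k.2
      simp only [natDegree_X_pow]
      omega) (by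
      simp only [Fintype.card_prod, Fintype.card_fin]
      have h1 : c * (m * B) + B = s * B := by
        have : c * (m * B) = (c * m) * B := by ring
        rw [this, hsm]; ring
      have h2 : s * B = s * c + s * D + 3 * s := by rw [hB]; ring
      omega)
  -- the auxiliary polynomial
  set G : K[X] := ∑ t : Fin c × Fin m × Fin B,
    C (b t ^ s) * (X ^ ((t.1 : ℕ) + s * t.2.2) * g ^ (t.2.1 : ℕ)) with hG
  have hGne : G ≠ 0 := by
    have := sum_ne_zero_of_orders (fun t => b t ^ s)
      (fun t : Fin c × Fin m × Fin B => (t.1 : ℕ) + c * t.2.1 + s * t.2.2) ?_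
      (fun t => f ^ (c * t.2.1)) ?_ ?_
    · convert this using 2
      rename_i t
      rw [hg, ← pow_mul, mul_pow]
      ring
    · rintro ⟨i, j, k⟩ ⟨i', j', k'⟩ h
      simp only at h
      have hi := i.2
      have hi' := i'.2
      have hlt : ∀ (i : Fin c) (j : Fin m), (i : ℕ) + c * j < s := by
        intro i j
        have : c * (j + 1 : ℕ) ≤ c * m := by gcongr; omega
        have := i.2
        rw [mul_add] at *
        omega
      have hk : (k : ℕ) = k' := by
        have := congrArg (· / s) h
        beta_reduce at this
        rwa [Nat.add_mul_div_left _ _ (by omega), Nat.add_mul_div_left _ _ (by omega),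
          Nat.div_eq_of_lt (hlt i j), Nat.div_eq_of_lt (hlt i' j'), zero_add, zero_add] at this
      have h2 : (i : ℕ) + c * j = i' + c * j' := by rw [hk] at h; omega
      have hj : (j : ℕ) = j' := by
        have := congrArg (· / c) h2
        beta_reduce at this
        rwa [Nat.add_mul_div_left _ _ (by omega), Nat.add_mul_div_left _ _ (by omega),
          Nat.div_eq_of_lt hi, Nat.div_eq_of_lt hi', zero_add, zero_add] at this
      have hii : (i : ℕ) = i' := by rw [hj] at h2; omega
      simp [Fin.ext_iff, hk, hj, hii]
    · intro t; rw [eval_pow]; exact pow_ne_zero _ h0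
    · obtain ⟨t, ht⟩ := hbne; exact ⟨t, pow_ne_zero _ ht⟩
  have hGdeg : G.natDegree ≤ s * c + s * (2 * D + 4) := by
    refine natDegree_sum_le_of_forall_le _ _ ?_
    rintro ⟨i, j, k⟩ _
    refine (natDegree_C_mul_le _ _).trans (natDegree_mul_le.trans ?_)
    have h1 : (g ^ (j : ℕ)).natDegree ≤ s * D := by
      refine natDegree_pow_le.trans ?_
      calc (j : ℕ) * g.natDegree ≤ m * (c * D) := by gcongr; omega
        _ = (m * c) * D := by ring
        _ ≤ s * D := by gcongr; omega
    have h2 : s * (k : ℕ) ≤ s * B := by gcongr; omega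
    have h3 := i.2
    have h4 : s * B = s * c + s * D + 3 * s := by rw [hB]; ring
    have h5 : s * (2 * D + 4) = s * D + s * D + 4 * s := by ring
    simp only [natDegree_X_pow]
    omega
  have hroots : (Finset.univ.filter fun x : K => (x * f.eval x) ^ (c * (s + 1)) = ζ) ⊆
      G.roots.toFinset := by
    intro x hx
    simp only [Finset.mem_filter, Finset.mem_univ, true_and] at hx
    rw [Multiset.mem_toFinset, mem_roots hGne, IsRoot.def]
    set w := g.eval x with hw
    have hw1 : w ^ s * w = ζ := by
      rw [← hx, hw, hg, eval_pow, eval_mul, eval_X, ← pow_succ, ← pow_mul]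
    have hw0 : w ≠ 0 := by
      rintro h; rw [h, mul_zero] at hw1; exact hζ hw1.symm
    have hxN : ∀ y : K, (y ^ s) ^ s = y := by
      intro y
      rw [← pow_mul, ← sq, ← hs, FiniteField.pow_card]
    have hpow : (G.eval x) ^ s * w ^ (m - 1) = 0 := by
      have h1 : (G.eval x) ^ s = iterateFrobenius K p e (G.eval x) := by
        rw [iterateFrobenius_def, hsp]
      rw [h1, hG, eval_finsetSum, map_sum]
      have h2 := congrArg (eval x) hb
      rw [eval_finsetSum, eval_zero] at h2
      rw [Finset.sum_mul, ← h2]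
      refine Finset.sum_congr rfl ?_
      rintro ⟨i, j, k⟩ _
      rw [iterateFrobenius_def, ← hsp]
      simp only [eval_mul, eval_C, eval_pow, eval_X, mul_pow, ← hw]
      rw [hxN]
      have h3 : (x ^ ((i : ℕ) + s * k)) ^ s = x ^ (s * i + k : ℕ) := by
        rw [pow_add, mul_pow, pow_mul x s k, ← pow_mul (x ^ s) k s, mul_comm (k : ℕ) s,
          pow_mul (x ^ s) s k, hxN, pow_add, ← pow_mul, mul_comm (i : ℕ) s]
      have h4 : (w ^ (j : ℕ)) ^ s * w ^ (m - 1) = ζ ^ (j : ℕ) * w ^ (m - 1 - (j : ℕ)) := by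
        rw [← hw1, mul_pow, ← pow_mul, ← pow_mul, mul_assoc, ← pow_add, mul_comm (j : ℕ) s]
        have hj := j.2
        have h6 : (j : ℕ) + (m - 1 - j) = m - 1 := by omega
        rw [← pow_add, h6, pow_add]
      rw [h3, mul_assoc, mul_assoc, h4]
      ring
    have h5 := (mul_eq_zero.mp hpow).resolve_right (pow_ne_zero _ hw0)
    exact pow_eq_zero_iff (by omega) |>.mp h5
  have hcard : (Finset.univ.filter fun x : K => (x * f.eval x) ^ (c * (s + 1)) = ζ).card
      ≤ s * c + s * (2 * D + 4) :=
    (Finset.card_le_card hroots).trans ((Multiset.toFinset_card_le _).trans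
      ((card_roots' G).trans hGdeg))
  calc _ ≤ m * (s * c + s * (2 * D + 4)) := by gcongr
    _ = s * (m * c) + m * (2 * D + 4) * s := by ring
    _ ≤ s * s + m * (2 * D + 4) * s := by gcongr; omega
    _ = _ := by ring

theorem monic_set_finite (F : Type*) [Field F] [Finite F] (k : ℕ) :
    {g : F[X] | g.Monic ∧ g.natDegree = k}.Finite := by
  have : Finite (Fin (k + 1) → F) := inferInstance
  refine Set.Finite.of_injOn (f := fun g (i : Fin (k + 1)) => g.coeff i) (t := Set.univ)
    (fun _ _ => Set.mem_univ _) ?_ Set.finite_univ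
  intro g hg h hh hgh
  ext i
  by_cases hi : i < k + 1
  · exact congrFun hgh ⟨i, hi⟩
  · rw [coeff_eq_zero_of_natDegree_lt (by rw [hg.2]; omega),
      coeff_eq_zero_of_natDegree_lt (by rw [hh.2]; omega)]

/-- The finset of monic polynomials of degree `k`. -/
noncomputable def monics (F : Type*) [Field F] [Finite F] (k : ℕ) : Finset F[X] :=
  (monic_set_finite F k).toFinset

theorem mem_monics {F : Type*} [Field F] [Finite F] {k : ℕ} {g : F[X]} :
    g ∈ monics F k ↔ g.Monic ∧ g.natDegree = k := by
  simp [monics]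

theorem eq_of_dvd_pow_monic {F : Type*} [Field F] {p r : F[X]} (hp : p.Monic)
    (hpi : Irreducible p) (hr : r.Monic) (hri : Irreducible r) {e : ℕ} (h : p ∣ r ^ e) : p = r :=
  eq_of_monic_of_associated hp hr (hpi.associated_of_dvd hri (hpi.prime.dvd_of_dvd_pow h))

theorem Lam_pow {F : Type*} [Field F] {p : F[X]} (hp : p.Monic) (hpi : Irreducible p) {e : ℕ}
    (he : 0 < e) : Lam (p ^ e) = p.natDegree := by
  have h : IsPrimaryPoly (p ^ e) := ⟨p, hp, hpi, e, he, rfl⟩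
  unfold Lam
  rw [dif_pos h]
  obtain ⟨h1, h2, e', he', h3⟩ := h.choose_spec
  have h4 : p ∣ h.choose ^ e' := by
    rw [← h3]; exact dvd_pow_self p he.ne'
  exact (congrArg natDegree (eq_of_dvd_pow_monic hp hpi h1 h2 h4)).symm

theorem Lam_eq_zero {F : Type*} [Field F] {g : F[X]} (h : ¬ IsPrimaryPoly g) : Lam g = 0 := by
  unfold Lam
  rw [dif_neg h]

/-- The characteristic polynomial of `a` over `F`. -/
noncomputable def cpoly (F : Type*) {K : Type*} [Field F] [Field K] [Algebra F K] (a : K) : F[X] :=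
  (minpoly F a) ^ (Module.finrank F K / (minpoly F a).natDegree)

theorem cpoly_spec {F K : Type*} [Field F] [Field K] [Algebra F K] [Finite K] (a : K) :
    (cpoly F a).map (algebraMap F K) =
      ∏ i ∈ Finset.range (Module.finrank F K), (X - C (a ^ (Nat.card F ^ i))) := by
  classical
  have := Finite.of_injective _ (FaithfulSMul.algebraMap_injective F K)
  have := Fintype.ofFinite F
  have hint : IsIntegral F a := Algebra.IsIntegral.isIntegral a
  have hpi := minpoly.irreducible hint
  have hpm := minpoly.monic hint
  obtain ⟨P, hPm⟩ := (mem_lifts _).mp (Algebra.IsInvariant.charpoly_mem_lifts F K Gal(K/F) a)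
  have hPr : P.map (algebraMap F K) =
      ∏ i ∈ Finset.range (Module.finrank F K), (X - C (a ^ (Nat.card F ^ i))) := by
    rw [hPm, MulSemiringAction.charpoly, Finset.prod_range]
    exact Eq.symm <| Fintype.prod_bijective _
      (FiniteField.bijective_frobeniusAlgEquivOfAlgebraic_pow F K) _ _ <|
      fun i ↦ by rw [AlgEquiv.smul_def, AlgEquiv.coe_pow,
        FiniteField.coe_frobeniusAlgEquivOfAlgebraic_iterate, Fintype.card_eq_nat_card]
  have hPmonic : P.Monic := by
    have : (P.map (algebraMap F K)).Monic := by
      rw [hPr]; exact monic_prod_of_monic _ _ fun i _ => monic_X_sub_C _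
    exact monic_of_injective (algebraMap F K).injective this
  have hdeg : P.natDegree = Module.finrank F K := by
    rw [← natDegree_map (algebraMap F K), hPr, natDegree_prod_of_monic _ _
      fun i _ => monic_X_sub_C _]
    simp only [natDegree_X_sub_C, Finset.sum_const, Finset.card_range, smul_eq_mul, mul_one]
  have hdvd : P ∣ (minpoly F a) ^ (Module.finrank F K) := by
    rw [← map_dvd_map' (algebraMap F K), hPm, Polynomial.map_pow, MulSemiringAction.charpoly]
    have hc : Module.finrank F K = (Finset.univ : Finset Gal(K/F)).card := by
      rw [Finset.card_univ, ← Nat.card_eq_fintype_card, IsGalois.card_aut_eq_finrank]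
    rw [hc, ← Finset.prod_const]
    refine Finset.prod_dvd_prod_of_dvd _ _ ?_
    intro σ _
    rw [dvd_iff_isRoot, IsRoot.def, eval_map_algebraMap, AlgEquiv.smul_def,
      ← minpoly.algEquiv_eq σ a, minpoly.aeval]
  obtain ⟨t, _, ht⟩ := (dvd_prime_pow hpi.prime _).mp hdvd
  have ht := eq_of_monic_of_associated hPmonic (hpm.pow t) ht
  have : cpoly F a = P := by
    rw [cpoly, ← hdeg, ht, natDegree_pow, Nat.mul_div_cancel _ hpi.natDegree_pos]
  rw [this, hPr]

theorem sum_cpoly {F K : Type*} [Field F] [Finite F] [Field K] [Algebra F K] [Fintype K]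
    (φ : F[X] → ℂ) :
    ∑ a : K, φ (cpoly F a) = ∑ g ∈ monics F (Module.finrank F K), (Lam g : ℂ) * φ g := by
  classical
  have hint : ∀ a : K, IsIntegral F a := Algebra.IsIntegral.isIntegral
  have hdvd : ∀ a : K, (minpoly F a).natDegree ∣ Module.finrank F K := fun a =>
    minpoly.degree_dvd (hint a)
  have hpos : ∀ a : K, 0 < Module.finrank F K / (minpoly F a).natDegree := fun a =>
    Nat.div_pos (Nat.le_of_dvd Module.finrank_pos (hdvd a)) (minpoly.natDegree_pos (hint a))
  rw [← Finset.sum_fiberwise_of_maps_to (s := Finset.univ) (t := monics F (Module.finrank F K))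
    (g := fun a : K => cpoly F a)]
  · refine Finset.sum_congr rfl ?_
    intro g hg
    rw [mem_monics] at hg
    rw [Finset.sum_congr rfl (g := fun _ => φ g)
      (fun a ha => by rw [(Finset.mem_filter.mp ha).2]), Finset.sum_const, nsmul_eq_mul]
    congr 2
    by_cases hprim : IsPrimaryPoly g
    · obtain ⟨p, hpm, hpi, e, he, rfl⟩ := hprim
      rw [Lam_pow hpm hpi he]
      have hdeg : p.natDegree ∣ Module.finrank F K := by
        rw [← hg.2, natDegree_pow]; exact dvd_mul_left _ _
      have hsplit : (p.map (algebraMap F K)).Splits := by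
        have h1 := hpi.natDegree_dvd_iff_dvd_X_pow_card_pow_sub_X.mp hdeg
        have := Fintype.ofFinite F
        rw [← Module.natCard_eq_pow_finrank, Nat.card_eq_fintype_card] at h1
        have h2 := (FiniteField.isSplittingField_sub K F).splits
        refine Splits.of_dvd h2 ?_ (map_dvd (algebraMap F K) h1)
        exact map_ne_zero (FiniteField.X_pow_card_sub_X_ne_zero _ Fintype.one_lt_card)
      have hsep : p.Separable := PerfectField.separable_of_irreducible hpi
      rw [← card_rootSet_eq_natDegree hsep hsplit, ← Set.toFinset_card]
      congr 1
      ext a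
      simp only [Finset.mem_filter, Finset.mem_univ, true_and, Set.mem_toFinset]
      rw [mem_rootSet_of_ne hpi.ne_zero]
      constructor
      · intro h
        have h1 : minpoly F a = p := by
          refine eq_of_dvd_pow_monic (e := e) (minpoly.monic (hint a)) (minpoly.irreducible (hint a)) hpm hpi ?_
          rw [← h, cpoly]
          exact dvd_pow_self _ (hpos a).ne'
        rw [← h1, minpoly.aeval]
      · intro h
        have h1 : p = minpoly F a := minpoly.eq_of_irreducible_of_monic hpi h hpm
        rw [cpoly, ← h1, ← hg.2, natDegree_pow, Nat.mul_div_cancel _ hpi.natDegree_pos]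
    · rw [Lam_eq_zero hprim, Finset.card_eq_zero, Finset.filter_eq_empty_iff]
      intro a _ h
      exact hprim ⟨minpoly F a, minpoly.monic (hint a), minpoly.irreducible (hint a), _, hpos a,
        h.symm⟩
  · intro a _
    rw [mem_monics]
    refine ⟨(minpoly.monic (hint a)).pow _, ?_⟩
    rw [cpoly, natDegree_pow, Nat.div_mul_cancel (hdvd a)]

theorem prod_range_mul_eq {M : Type*} [CommMonoid M] (g : ℕ → M) (n m : ℕ) :
    ∏ j ∈ Finset.range (n * m), g j =
      ∏ i ∈ Finset.range n, ∏ l ∈ Finset.range m, g (i + n * l) := by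
  induction m with
  | zero => simp
  | succ m ih =>
    simp only [Finset.prod_range_succ, Finset.prod_mul_distrib, mul_add, mul_one,
      Finset.prod_range_add, ih]
    congr 1
    exact Finset.prod_congr rfl fun i _ => by rw [add_comm]

theorem equidist_bound {E K : Type*} [Field E] [Fintype E] [DecidableEq E] [Fintype K]
    (val : K → E) (χ : MulChar E ℂ) (hχ : χ ≠ 1) (m R Z : ℕ) (hm : m + 1 = Fintype.card E)
    (hm1 : 1 ≤ m)
    (h : ∀ w : E, w ≠ 0 → m * (Finset.univ.filter fun x => val x = w).card ≤ Fintype.card K + R)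
    (hZ : (Finset.univ.filter fun x => val x = 0).card ≤ Z) :
    ‖∑ x, χ (val x)‖ ≤ R + Z := by
  classical
  set N : E → ℕ := fun w => (Finset.univ.filter fun x => val x = w).card with hN
  have hm0 : (m : ℝ) ≠ 0 := by positivity
  set c : ℝ := ((Fintype.card K : ℝ) + R) / m with hc
  have hle : ∀ w : E, w ≠ 0 → (N w : ℝ) ≤ c := by
    intro w hw
    rw [hc, le_div_iff₀ (by positivity)]
    have := h w hw
    have h2 : ((m * N w : ℕ) : ℝ) ≤ ((Fintype.card K + R : ℕ) : ℝ) := by exact_mod_cast this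
    push_cast at h2
    linarith
  have hsumN : ∑ w ∈ Finset.univ.erase (0 : E), (N w : ℝ) + N 0 = Fintype.card K := by
    rw [Finset.sum_erase_add _ _ (Finset.mem_univ _)]
    have := Finset.card_eq_sum_card_fiberwise (f := val) (s := Finset.univ) (t := Finset.univ)
      (fun _ _ => Finset.mem_coe.2 (Finset.mem_univ _))
    rw [Finset.card_univ] at this
    rw [this]; push_cast; rfl
  have h1 : ∑ x, χ (val x) = ∑ w ∈ Finset.univ.erase (0 : E), χ w * (((N w : ℝ) - c : ℝ) : ℂ) := by
    rw [← Finset.sum_fiberwise_of_maps_to (s := Finset.univ) (t := Finset.univ) (g := val)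
      (fun _ _ => Finset.mem_univ _)]
    have h2 : ∑ w ∈ Finset.univ.erase (0 : E), χ w = 0 := by
      rw [Finset.sum_erase _ (MulChar.map_nonunit χ not_isUnit_zero)]
      exact MulChar.sum_eq_zero_of_ne_one hχ
    simp only [Complex.ofReal_sub, mul_sub]
    rw [Finset.sum_sub_distrib, ← Finset.sum_mul, h2, zero_mul, sub_zero, Finset.sum_erase]
    · refine Finset.sum_congr rfl ?_
      intro w _
      rw [Finset.sum_congr rfl (g := fun _ => χ w)
        (fun a ha => by rw [(Finset.mem_filter.mp ha).2]), Finset.sum_const, nsmul_eq_mul, mul_comm]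
      simp [hN]
    · rw [MulChar.map_nonunit χ not_isUnit_zero, zero_mul]
  rw [h1]
  calc _ ≤ ∑ w ∈ Finset.univ.erase (0 : E), (c - N w) := by
        refine (norm_sum_le _ _).trans (Finset.sum_le_sum ?_)
        intro w hw
        have h3 := hle w (Finset.ne_of_mem_erase hw)
        rw [norm_mul, Complex.norm_real, Real.norm_eq_abs, abs_of_nonpos (by linarith)]
        have h4 : ‖χ w‖ = 1 := by
          have hu : IsUnit w := (Finset.ne_of_mem_erase hw).isUnit
          have h5 : χ w ^ (Fintype.card E - 1) = 1 := by
            rw [← map_pow, FiniteField.pow_card_sub_one_eq_one w (Finset.ne_of_mem_erase hw), map_one]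
          exact Complex.norm_eq_one_of_pow_eq_one h5 (by omega)
        rw [h4]; linarith
    _ = R + N 0 := by
        rw [Finset.sum_sub_distrib, Finset.sum_const, Finset.card_erase_of_mem (Finset.mem_univ _),
          Finset.card_univ, ← hm, Nat.add_sub_cancel, nsmul_eq_mul, hc, mul_div_cancel₀ _ hm0]
        linarith
    _ ≤ R + Z := by
        have : (N 0 : ℝ) ≤ Z := by exact_mod_cast hZ
        linarith

theorem frob_ne {F E : Type*} [Field F] [Finite F] [Field E] [Finite E] [Algebra F E] (α : E)
    (n : ℕ) (hα : (minpoly F α).natDegree = n) (j : ℕ) (hj : 0 < j) (hjn : j < n) :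
    α ^ (Nat.card F ^ j) ≠ α := by
  intro h
  have hint : IsIntegral F α := Algebra.IsIntegral.isIntegral α
  have h1 : minpoly F α ∣ X ^ (Nat.card F) ^ j - X := by
    apply minpoly.dvd
    simp [h]
  have := (minpoly.irreducible hint).natDegree_dvd_of_dvd_X_pow_card_pow_sub_X h1
  rw [hα] at this
  exact absurd (Nat.le_of_dvd hj this) (by omega)

/-- Exponential-sum bound over the big field. -/
theorem big_field_bound {F E K : Type*} [Field F] [Fintype F] [Field E] [Fintype E] [Algebra F E]
    [Field K] [Fintype K] [Algebra F K] [Algebra E K] [IsScalarTower F E K]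
    (q n r : ℕ) (hcardF : Fintype.card F = q) (hcardE : Fintype.card E = q ^ n)
    (hn : 1 < n) (hr : 1 ≤ r) (α : E) (hα : (minpoly F α).natDegree = n)
    (hK : Fintype.card K = (q ^ n) ^ (2 * r)) (χ : MulChar E ℂ) (hχ : χ ≠ 1)
    (D : ℕ) (hD : D = ∑ i ∈ Finset.range n, q ^ i)
    (hbig : 2 * D + 6 ≤ (q ^ n) ^ r) :
    ‖∑ a : K, χ (aeval α (cpoly F a))‖ ≤ ((q ^ n - 1) * (2 * D + 4) * (q ^ n) ^ r + D : ℕ) := by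
  classical
  obtain ⟨p, hp⟩ := CharP.exists F
  have hpp : Fact p.Prime := ⟨CharP.char_is_prime F p⟩
  have hpK : CharP K p := charP_of_injective_algebraMap (algebraMap F K).injective p
  obtain ⟨u, _, hu⟩ := FiniteField.card F p
  rw [hcardF] at hu
  have hq2 : 2 ≤ q := hcardF ▸ Fintype.one_lt_card
  set Q := q ^ n with hQ
  have hQ2 : 2 ≤ Q := hcardE ▸ Fintype.one_lt_card
  set s := Q ^ r with hs
  have hQdvd : (Q - 1) ∣ s - 1 := by simpa using Nat.sub_dvd_pow_sub_pow Q 1 r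
  obtain ⟨c, hc⟩ := hQdvd
  have hs1 : 1 ≤ s := Nat.one_le_pow _ _ (by omega)
  have hsc : s = (Q - 1) * c + 1 := by omega
  have hfin : Module.finrank F K = n * (2 * r) := by
    have h1 := Module.card_eq_pow_finrank (K := F) (V := K)
    rw [hK, hcardF, hQ, ← pow_mul] at h1
    exact (Nat.pow_right_injective hq2 h1).symm
  -- geometric sum
  have hgeom : ∑ l ∈ Finset.range (2 * r), Q ^ l = c * (s + 1) := by
    have h1 := Nat.geomSum_eq hQ2 (2 * r)
    rw [h1]
    apply Nat.div_eq_of_eq_mul_right (by omega)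
    have h2 : Q ^ (2 * r) = s * s := by rw [hs, ← pow_add]; congr 1; omega
    rw [h2]
    have h3 : s * s - 1 = (s - 1) * (s + 1) := by
      rw [mul_comm (s - 1), ← Nat.sq_sub_sq, one_pow, sq]
    rw [h3, hc]; ring
  set ι := algebraMap E K with hι
  set αi : ℕ → K := fun i => ι α ^ q ^ (n - i) with hαi
  have hιQ : ∀ (e : E) (l : ℕ), (ι e) ^ Q ^ l = ι e := by
    intro e l
    rw [← map_pow, ← hcardE, FiniteField.pow_card_pow]
  have hqchar : ∀ (i : ℕ) (x y : K), (x - y) ^ q ^ i = x ^ q ^ i - y ^ q ^ i := by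
    intro i x y
    rw [hu, ← pow_mul]
    exact sub_pow_char_pow ..
  have hQpow : ∀ l, Q ^ l = q ^ (n * l) := fun l => by rw [hQ, pow_mul]
  set f : K[X] := ∏ i ∈ Finset.range (n - 1), (X + C (αi (i + 1) - ι α)) ^ q ^ (i + 1) with hf
  have hf0 : f.eval 0 ≠ 0 := by
    rw [hf, eval_prod, Finset.prod_ne_zero_iff]
    intro i hi
    rw [Finset.mem_range] at hi
    rw [eval_pow]
    apply pow_ne_zero
    simp only [eval_add, eval_X, eval_C, zero_add]
    rw [sub_ne_zero, hαi]
    simp only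
    rw [← map_pow, ι.injective.ne_iff, ← hcardF, ← Nat.card_eq_fintype_card]
    exact frob_ne α n hα _ (by omega) (by omega)
  have hDf : f.natDegree + 1 ≤ D := by
    have h1 : f.natDegree ≤ ∑ i ∈ Finset.range (n - 1), q ^ (i + 1) := by
      refine (natDegree_prod_le _ _).trans (Finset.sum_le_sum fun i _ => ?_)
      refine natDegree_pow_le.trans ?_
      rw [natDegree_X_add_C, mul_one]
    rw [hD]
    obtain ⟨n', rfl⟩ : ∃ n', n = n' + 1 := ⟨n - 1, by omega⟩
    rw [Finset.sum_range_succ']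
    simpa using h1
  -- the main identity
  have hmain : ∀ x : K, ι (aeval α (cpoly F (ι α - x))) = (x * f.eval x) ^ (c * (s + 1)) := by
    intro x
    obtain ⟨a, ha⟩ : ∃ a, a = ι α - x := ⟨_, rfl⟩
    rw [← ha]
    have h1 : ι (aeval α (cpoly F a)) = ∏ j ∈ Finset.range (n * (2 * r)), (ι α - a ^ q ^ j) := by
      rw [hι, ← aeval_algebraMap_apply, ← eval_map_algebraMap, cpoly_spec, hfin, eval_prod,
        Nat.card_eq_fintype_card, hcardF]
      simp only [eval_sub, eval_X, eval_C]
    have h2 : ∏ j ∈ Finset.range (n * (2 * r)), (ι α - a ^ q ^ j) =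
        ∏ i ∈ Finset.range n, ∏ l ∈ Finset.range (2 * r), (ι α - a ^ q ^ (i + n * l)) := by
      exact prod_range_mul_eq (fun j => ι α - a ^ q ^ j) n (2 * r)
    have h3 : ∀ i < n, ∏ l ∈ Finset.range (2 * r), (ι α - a ^ q ^ (i + n * l)) =
        ((αi i - a) ^ q ^ i) ^ (c * (s + 1)) := by
      intro i hi
      rw [← hgeom, ← Finset.prod_pow_eq_pow_sum]
      refine Finset.prod_congr rfl fun l _ => ?_
      rw [← pow_mul, mul_comm (q ^ i), pow_mul]
      have h4 : (αi i - a) ^ Q ^ l = αi i - a ^ Q ^ l := by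
        rw [hQpow, hqchar]
        congr 1
        rw [hαi]; simp only
        rw [← map_pow, ← hQpow, hιQ]
      rw [h4, hqchar]
      congr 1
      · rw [hαi]; simp only
        rw [← pow_mul, ← pow_add, Nat.sub_add_cancel hi.le, ← hQ]
        simpa using (hιQ α 1).symm
      · rw [← pow_mul, hQpow, ← pow_add]; congr 2; omega
    rw [h1, h2, Finset.prod_congr rfl fun i hi => h3 i (Finset.mem_range.mp hi), Finset.prod_pow]
    congr 1
    obtain ⟨n', hn'⟩ : ∃ n', n = n' + 1 := ⟨n - 1, by omega⟩
    rw [hn', Finset.prod_range_succ', mul_comm]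
    congr 1
    · have : αi 0 = ι α := by
        rw [hαi]; simp only [Nat.sub_zero]
        rw [← hQ]; simpa using hιQ α 1
      rw [this, ha]; simp
    · rw [hf, eval_prod, hn', Nat.add_sub_cancel]
      refine Finset.prod_congr rfl fun i _ => ?_
      simp only [eval_pow, eval_add, eval_X, eval_C]
      rw [ha]; congr 1; ring
  have hsum : ∑ a : K, χ (aeval α (cpoly F a)) = ∑ x : K, χ (aeval α (cpoly F (ι α - x))) :=
    ((Equiv.subLeft (ι α)).sum_comp fun a => χ (aeval α (cpoly F a))).symm
  rw [hsum]
  have := equidist_bound (fun x : K => aeval α (cpoly F (ι α - x))) χ hχ (Q - 1)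
    ((Q - 1) * (2 * D + 4) * s) D (by omega) (by omega) ?_ ?_
  · exact_mod_cast this
  · intro w hw
    have hcK : Fintype.card K = s ^ 2 := by rw [hK, hs, ← pow_mul Q r 2, mul_comm]
    have hst := stepanov_s3 (K := K) p (u * n * r) s (Q - 1) c D
      (by rw [hs, hQ, hu, ← pow_mul, ← pow_mul, mul_assoc])
      hcK hsc (by omega) f hf0 hDf (ι w)
      (by simpa using hw) hbig
    rw [hcK]
    convert hst using 4
    rw [← hmain, ι.injective.eq_iff]
  · have hne : X * f ≠ 0 := mul_ne_zero X_ne_zero (by rintro h; simp [h] at hf0)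
    have hsub : (Finset.univ.filter fun x : K => aeval α (cpoly F (ι α - x)) = 0) ⊆
        (X * f).roots.toFinset := by
      intro x hx
      simp only [Finset.mem_filter, Finset.mem_univ, true_and] at hx
      rw [Multiset.mem_toFinset, mem_roots hne, IsRoot.def, eval_mul, eval_X]
      have := hmain x
      rw [hx, map_zero] at this
      exact eq_zero_of_pow_eq_zero this.symm
    refine (Finset.card_le_card hsub).trans ((Multiset.toFinset_card_le _).trans
      ((card_roots' _).trans (natDegree_mul_le.trans ?_)))
    rw [natDegree_X]; omega

theorem exists_extension_bound {F E : Type*} [Field F] [Fintype F] [Field E] [Fintype E]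
    [Algebra F E] (q n : ℕ) (hcardF : Fintype.card F = q) (hcardE : Fintype.card E = q ^ n)
    (hn : 1 < n) (α : E) (hα : (minpoly F α).natDegree = n) (χ : MulChar E ℂ) (hχ : χ ≠ 1) :
    ∃ (A : ℝ) (r0 : ℕ), ∀ r ≥ r0,
      ‖∑ g ∈ monics F (n * (2 * r)), (Lam g : ℂ) * χ (aeval α g)‖ ≤ A * ((q : ℝ) ^ n) ^ r := by
  obtain ⟨p, hp⟩ := CharP.exists E
  have hpp : Fact p.Prime := ⟨CharP.char_is_prime E p⟩
  set D := ∑ i ∈ Finset.range n, q ^ i with hD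
  refine ⟨((q ^ n - 1 : ℕ) * (2 * D + 4) + D : ℝ), 2 * D + 6, fun r hr => ?_⟩
  have hQ2 : 2 ≤ q ^ n := hcardE ▸ Fintype.one_lt_card
  have hq2 : 2 ≤ q := hcardF ▸ Fintype.one_lt_card
  have : NeZero (2 * r) := ⟨by omega⟩
  let K := FiniteField.Extension E p (2 * r)
  letI : Fintype K := Fintype.ofFinite K
  letI : Algebra F K := ((algebraMap E K).comp (algebraMap F E)).toAlgebra
  haveI : IsScalarTower F E K := IsScalarTower.of_algebraMap_eq' rfl
  have hK : Fintype.card K = (q ^ n) ^ (2 * r) := by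
    rw [← Nat.card_eq_fintype_card, FiniteField.natCard_extension, Nat.card_eq_fintype_card, hcardE]
  have hbig : 2 * D + 6 ≤ (q ^ n) ^ r :=
    hr.le.trans (Nat.lt_pow_self (by omega)).le
  have hb := big_field_bound (K := K) q n r hcardF hcardE hn (by omega) α hα hK χ hχ D hD hbig
  have hfin : Module.finrank F K = n * (2 * r) := by
    have h1 := Module.card_eq_pow_finrank (K := F) (V := K)
    rw [hK, hcardF, ← pow_mul] at h1
    exact (Nat.pow_right_injective hq2 h1).symm
  rw [sum_cpoly (K := K) (fun g => χ (aeval α g)), hfin] at hb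
  refine hb.trans ?_
  have h1 : (1 : ℝ) ≤ ((q : ℝ) ^ n) ^ r := by
    apply one_le_pow₀; apply one_le_pow₀; exact_mod_cast (by omega : 1 ≤ q)
  push_cast
  have h2 : (0 : ℝ) ≤ (D : ℝ) := by positivity
  nlinarith

open Classical in
theorem sum_Lam_dvd {F : Type*} [Field F] [Finite F] {k : ℕ} {g : F[X]} (hg : g ∈ monics F k) :
    ∑ h ∈ ((Finset.range (k + 1)).biUnion (monics F)) with h ∣ g, Lam h = k := by
  classical
  rw [mem_monics] at hg
  have hg0 : g ≠ 0 := hg.1.ne_zero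
  set nf := UniqueFactorizationMonoid.normalizedFactors g with hnf
  have hirr : ∀ p ∈ nf, Irreducible p := fun p hp =>
    UniqueFactorizationMonoid.irreducible_of_normalized_factor p hp
  have hmon : ∀ p ∈ nf, p.Monic := fun p hp => by
    have h := UniqueFactorizationMonoid.normalize_normalized_factor p hp
    rw [← h]; exact monic_normalize (hirr p hp).ne_zero
  have hprod : nf.prod = g := by
    have h := UniqueFactorizationMonoid.prod_normalizedFactors_eq hg0
    rw [← hnf, hg.1.normalize_eq_self] at h
    exact h
  have hdeg : k = ∑ p ∈ nf.toFinset, ∑ j ∈ Finset.range (nf.count p), p.natDegree := by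
    rw [← hg.2]
    conv_lhs => rw [← hprod]
    rw [natDegree_multiset_prod_of_monic _ hmon, Finset.sum_multiset_map_count]
    refine Finset.sum_congr rfl fun p _ => ?_
    simp
  have hcount : ∀ p ∈ nf, ∀ j, p ^ j ∣ g ↔ j ≤ nf.count p := fun p hp j => by
    rw [pow_dvd_iff_le_emultiplicity,
      UniqueFactorizationMonoid.emultiplicity_eq_count_normalizedFactors (hirr p hp) hg0,
      (hmon p hp).normalize_eq_self]
    simp [hnf]
  conv_rhs => rw [hdeg]
  rw [Finset.sum_sigma']
  symm
  refine Finset.sum_of_injOn (fun x => x.1 ^ (x.2 + 1)) ?_ ?_ ?_ ?_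
  · rintro ⟨p, i⟩ hp ⟨r, j⟩ hr h
    simp only [Finset.coe_sigma, Set.mem_sigma_iff, Finset.mem_coe, Multiset.mem_toFinset,
      Finset.mem_range] at hp hr h
    have : p = r := eq_of_dvd_pow_monic (hmon p hp.1) (hirr p hp.1) (hmon r hr.1) (hirr r hr.1)
      (h ▸ dvd_pow_self p (Nat.succ_ne_zero i))
    subst this
    have h2 := congrArg natDegree h
    rw [natDegree_pow, natDegree_pow] at h2
    have := Nat.eq_of_mul_eq_mul_right (hirr p hp.1).natDegree_pos h2
    simp at this
    subst this; rfl
  · rintro ⟨p, i⟩ hp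
    simp only [Finset.coe_sigma, Set.mem_sigma_iff, Finset.mem_coe, Multiset.mem_toFinset,
      Finset.mem_range] at hp
    simp only [Finset.coe_filter, Set.mem_ofPred_eq, Finset.mem_biUnion, Finset.mem_range]
    have hd := (hcount p hp.1 (i + 1)).mpr hp.2
    refine ⟨⟨_, ?_, mem_monics.mpr ⟨(hmon p hp.1).pow _, rfl⟩⟩, hd⟩
    have := natDegree_le_of_dvd hd hg0
    rw [hg.2] at this
    omega
  · intro h hh hn
    by_contra hL
    have hprim : IsPrimaryPoly h := by
      by_contra h'
      exact hL (Lam_eq_zero h')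
    obtain ⟨p, hpm, hpi, e, he, rfl⟩ := hprim
    have hd := (Finset.mem_filter.mp hh).2
    have hpg : p ∣ g := (dvd_pow_self p he.ne').trans hd
    have hpn : p ∈ nf := by
      obtain ⟨r, hr, hpr⟩ := UniqueFactorizationMonoid.exists_mem_normalizedFactors_of_dvd hg0 hpi hpg
      rwa [eq_of_monic_of_associated hpm (hmon r hr) hpr]
    apply hn
    refine ⟨⟨p, e - 1⟩, ?_, ?_⟩
    · simp only [Finset.coe_sigma, Set.mem_sigma_iff, Finset.mem_coe, Multiset.mem_toFinset,
        Finset.mem_range]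
      refine ⟨hpn, ?_⟩
      have := (hcount p hpn e).mp hd
      omega
    · simp only
      congr 1; omega
  · rintro ⟨p, i⟩ hp
    simp only [Finset.mem_sigma, Multiset.mem_toFinset, Finset.mem_range] at hp
    rw [Lam_pow (hmon p hp.1) (hirr p hp.1) (Nat.succ_pos i)]

theorem mangoldt_rec {F : Type*} [Field F] [Finite F] (ψ : F[X] → ℂ)
    (hψ : ∀ g h, ψ (g * h) = ψ g * ψ h) (k : ℕ) :
    (k : ℂ) * ∑ g ∈ monics F k, ψ g =
      ∑ x ∈ Finset.HasAntidiagonal.antidiagonal k, (∑ h ∈ monics F x.1, (Lam h : ℂ) * ψ h) *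
        ∑ g ∈ monics F x.2, ψ g := by
  classical
  have h1 : (k : ℂ) * ∑ g ∈ monics F k, ψ g = ∑ g ∈ monics F k,
      ∑ i ∈ Finset.range (k + 1), ∑ h ∈ monics F i, if h ∣ g then (Lam h : ℂ) * ψ g else 0 := by
    rw [Finset.mul_sum]
    refine Finset.sum_congr rfl fun g hg => ?_
    conv_lhs => rw [← sum_Lam_dvd hg]
    rw [Nat.cast_sum, Finset.sum_filter, Finset.sum_biUnion, Finset.sum_mul]
    · refine Finset.sum_congr rfl fun i _ => ?_
      rw [Finset.sum_mul]
      refine Finset.sum_congr rfl fun h _ => ?_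
      split_ifs <;> simp
    · intro i _ j _ hij
      rw [Function.onFun, Finset.disjoint_left]
      intro a ha hb
      exact hij ((mem_monics.mp ha).2.symm.trans (mem_monics.mp hb).2)
  rw [h1, Finset.sum_comm, Finset.Nat.sum_antidiagonal_eq_sum_range_succ_mk]
  refine Finset.sum_congr rfl fun i hi => ?_
  rw [Finset.sum_comm, Finset.sum_mul]
  refine Finset.sum_congr rfl fun h hh => ?_
  rw [Finset.mul_sum, ← Finset.sum_filter]
  symm
  rw [mem_monics] at hh
  have hi : i ≤ k := by simpa [Nat.lt_succ_iff] using hi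
  refine Finset.sum_bij (fun g _ => h * g) ?_ ?_ ?_ ?_
  · intro g hg
    simp only [mem_monics] at hg
    rw [Finset.mem_filter, mem_monics]
    refine ⟨⟨hh.1.mul hg.1, ?_⟩, dvd_mul_right _ _⟩
    rw [hh.1.natDegree_mul hg.1, hh.2, hg.2]; omega
  · intro a _ b _ hab
    exact mul_left_cancel₀ hh.1.ne_zero hab
  · intro g hg
    rw [Finset.mem_filter, mem_monics] at hg
    obtain ⟨⟨hm, hd⟩, c, rfl⟩ := hg
    have hc := hh.1.of_mul_monic_left hm
    refine ⟨c, ?_, rfl⟩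
    rw [mem_monics]
    rw [hh.1.natDegree_mul hc, hh.2] at hd
    exact ⟨hc, by simp only; omega⟩
  · intro g _
    rw [hψ]; ring

theorem newton_roots (N : ℕ) (a S : ℕ → ℂ) (ha0 : a 0 = 1) (haN : ∀ k, N < k → a k = 0)
    (hrec : ∀ k : ℕ, (k : ℂ) * a k = ∑ x ∈ Finset.HasAntidiagonal.antidiagonal k, S x.1 * a x.2)  :
    ∃ z : Fin N → ℂ, ∀ d, 1 ≤ d → S d = - ∑ i, z i ^ d := by
  classical
  let P : ℂ[X] := X ^ N + ∑ i ∈ Finset.range N, C (a (N - i)) * X ^ i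
  have hlow : degree (∑ i ∈ Finset.range N, C (a (N - i)) * X ^ i) < (N : WithBot ℕ) := by
    refine (degree_sum_le _ _).trans_lt ((Finset.sup_lt_iff ?_).mpr ?_)
    · exact WithBot.bot_lt_coe N
    · intro i hi
      refine (degree_C_mul_X_pow_le _ _).trans_lt ?_
      exact_mod_cast Finset.mem_range.mp hi
  have hPm : P.Monic := monic_X_pow_add hlow
  have hPd : P.natDegree = N := by
    have : P.degree = N := by
      simp only [P]
      rw [degree_add_eq_left_of_degree_lt] <;> rw [degree_X_pow]
      exact hlow
    exact natDegree_eq_of_degree_eq_some this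
  have hPc : ∀ k ≤ N, P.coeff (N - k) = a k := by
    intro k hk
    simp only [P, coeff_add, coeff_X_pow, finsetSum_coeff, coeff_C_mul]
    rcases Nat.eq_zero_or_pos k with rfl | hk0
    · simp only [Nat.sub_zero, if_true, ha0]
      rw [Finset.sum_eq_zero]; · simp
      intro i hi
      rw [if_neg (by have := Finset.mem_range.mp hi; omega)]; simp
    · rw [if_neg (by omega), zero_add, Finset.sum_eq_single (N - k)]
      · simp [Nat.sub_sub_self hk]
      · intro b _ hb
        rw [if_neg (Ne.symm hb)]; simp
      · intro hb
        exact absurd (Finset.mem_range.mpr (by omega)) hb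
  have hcard : Multiset.card P.roots = P.natDegree :=
    splits_iff_card_roots.mp (IsAlgClosed.splits P)
  obtain ⟨l, hl⟩ := Quot.exists_rep P.roots
  have hlen : l.length = N := by
    rw [← hPd, ← hcard, ← hl]; rfl
  subst hlen
  refine ⟨fun i => l.get i, ?_⟩
  have hmap : (Finset.univ : Finset (Fin l.length)).val.map (fun i => l.get i) = P.roots := by
    rw [← hl]
    simp
  have hes : ∀ k, a k = (-1) ^ k * P.roots.esymm k := by
    intro k
    by_cases hk : k ≤ l.length
    · rw [← hPc k hk, coeff_eq_esymm_roots_of_card hcard (by omega), hPm.leadingCoeff, hPd,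
        Nat.sub_sub_self hk, one_mul]
    · rw [haN k (by omega), Multiset.esymm, Multiset.powersetCard_eq_empty]
      · simp
      · rw [hcard, hPd]; omega
  have hnewt : ∀ k : ℕ, (k : ℂ) * a k = - ∑ x ∈ Finset.HasAntidiagonal.antidiagonal k with x.1 < k,
      a x.1 * ∑ i, l.get i ^ x.2 := by
    intro k
    have h := congrArg (MvPolynomial.aeval (fun i => l.get i))
      (MvPolynomial.mul_esymm_eq_sum (Fin l.length) ℂ k)
    simp only [map_mul, map_natCast, map_pow, map_neg, map_one, map_sum,
      MvPolynomial.aeval_esymm_eq_multiset_esymm, hmap, MvPolynomial.psum,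
      MvPolynomial.aeval_X] at h
    rw [hes, mul_left_comm, h, ← mul_assoc, ← pow_add, show k + (k + 1) = 2 * k + 1 by ring]
    rw [pow_succ, pow_mul]
    simp [hes]
  intro d
  induction d using Nat.strong_induction_on with
  | _ d ih =>
    intro hd
    have h1 := (hrec d).symm.trans (hnewt d)
    have hS0 : S 0 = 0 := by
      have := hrec 0
      simpa [ha0] using this.symm
    rw [← Finset.sum_neg_distrib] at h1
    have h2 : ∑ x ∈ Finset.HasAntidiagonal.antidiagonal d, S x.1 * a x.2 =
        ∑ x ∈ Finset.HasAntidiagonal.antidiagonal d with x.1 < d, S x.2 * a x.1 := by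
      rw [← Finset.Nat.sum_antidiagonal_swap, Finset.sum_filter]
      refine Finset.sum_congr rfl fun x hx => ?_
      rw [Finset.HasAntidiagonal.mem_antidiagonal] at hx
      simp only [Prod.fst_swap, Prod.snd_swap]
      split_ifs with h
      · rfl
      · rw [show x.2 = 0 by omega, hS0, zero_mul]
    rw [h2] at h1
    have hmem : (0, d) ∈ Finset.filter (fun x : ℕ × ℕ => x.1 < d) (Finset.HasAntidiagonal.antidiagonal d) := by
      simp; omega
    rw [← Finset.add_sum_erase _ _ hmem, ← Finset.add_sum_erase _ _ hmem] at h1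
    have h3 : ∑ x ∈ (Finset.filter (fun x : ℕ × ℕ => x.1 < d) (Finset.HasAntidiagonal.antidiagonal d)).erase (0, d),
        S x.2 * a x.1 =
        ∑ x ∈ (Finset.filter (fun x : ℕ × ℕ => x.1 < d) (Finset.HasAntidiagonal.antidiagonal d)).erase (0, d),
        -(a x.1 * ∑ i, l.get i ^ x.2) := by
      refine Finset.sum_congr rfl fun x hx => ?_
      rw [Finset.mem_erase, Finset.mem_filter, Finset.HasAntidiagonal.mem_antidiagonal] at hx
      have hx1 : x.1 ≠ 0 := by
        intro h0
        apply hx.1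
        ext
        · exact h0
        · simp only; omega
      rw [ih x.2 (by omega) (by omega)]; ring
    rw [h3] at h1
    have h4 := add_right_cancel h1
    simpa [ha0] using h4

theorem growth_lemma {ι : Type*} [Fintype ι] (z : ι → ℂ) (ρ A : ℝ) (hρ : 0 < ρ) (r0 : ℕ)
    (h : ∀ r ≥ r0, ‖∑ i, z i ^ r‖ ≤ A * ρ ^ r) (i : ι) : ‖z i‖ ≤ ρ := by
  by_contra! hi
  let u : ι → Circle := fun i => Circle.exp (Complex.arg (z i))
  have hz : ∀ i r, z i ^ r = (‖z i‖ ^ r : ℝ) * ((u i ^ r : Circle) : ℂ) := by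
    intro i r
    have : z i = ‖z i‖ * ((u i : Circle) : ℂ) := by
      simp only [u, Circle.coe_exp]
      exact (Complex.norm_mul_exp_arg_mul_I (z i)).symm
    conv_lhs => rw [this]
    rw [mul_pow]; push_cast; rfl
  have hcl : MapClusterPt (1 : ι → Circle) Filter.atTop (u ^ · : ℕ → (ι → Circle)) :=
    mapClusterPt_one_atTop_pow u
  let W : Set (ι → Circle) := {v | ∀ i, (1 : ℝ) / 2 < ((v i : Circle) : ℂ).re}
  have hW : W ∈ nhds (1 : ι → Circle) := by
    have ho : IsOpen W := by
      have : W = ⋂ i, {v | (1 : ℝ) / 2 < ((v i : Circle) : ℂ).re} := by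
        ext; simp [W]
      rw [this]
      refine isOpen_iInter_of_finite fun i => ?_
      refine isOpen_lt continuous_const ?_
      exact Complex.continuous_re.comp (continuous_subtype_val.comp (continuous_apply i))
    refine ho.mem_nhds ?_
    intro i
    simp only [Pi.one_apply, Circle.coe_one, Complex.one_re]; norm_num
  have hfreq := hcl.frequently hW
  have hgrow : Filter.Tendsto (fun r : ℕ => (‖z i‖ / ρ) ^ r) Filter.atTop Filter.atTop :=
    tendsto_pow_atTop_atTop_of_one_lt ((one_lt_div hρ).mpr hi)
  obtain ⟨r, hr1, hr2, hr3⟩ := (hfreq.and_eventually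
    ((Filter.eventually_ge_atTop r0).and (hgrow.eventually_gt_atTop (2 * A)))).exists
  have h1 := h r hr2
  have h2 : (∑ i, z i ^ r).re ≤ A * ρ ^ r := (Complex.re_le_norm _).trans h1
  rw [Complex.re_sum] at h2
  have hterm : ∀ j, ‖z j‖ ^ r * (1 / 2) ≤ (z j ^ r).re := by
    intro j
    rw [hz, Complex.re_ofReal_mul]
    exact mul_le_mul_of_nonneg_left (hr1 j).le (by positivity)
  have h3 : (z i ^ r).re ≤ ∑ j, (z j ^ r).re :=
    Finset.single_le_sum (f := fun j => (z j ^ r).re)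
      (fun j _ => le_trans (by positivity) (hterm j)) (Finset.mem_univ i)
  have h4 := hterm i
  rw [div_pow, lt_div_iff₀ (by positivity)] at hr3
  linarith

theorem exists_low_poly {F E : Type*} [Field F] [Fintype F] [Field E] [Fintype E] [Algebra F E]
    (q n : ℕ) (hcardF : Fintype.card F = q) (hcardE : Fintype.card E = q ^ n)
    (hn : 1 < n) (α : E) (hα : (minpoly F α).natDegree = n) (γ : E) :
    ∃ r : F[X], r.degree < (n : WithBot ℕ) ∧ aeval α r = γ := by
  have hfin : Module.finrank F E = n := by
    have h1 := Module.card_eq_pow_finrank (K := F) (V := E)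
    rw [hcardE, hcardF] at h1
    have : 1 < q := hcardF ▸ Fintype.one_lt_card
    exact (Nat.pow_right_injective this h1).symm
  have hint : IsIntegral F α := Algebra.IsIntegral.isIntegral α
  have htop := (Field.primitive_element_iff_minpoly_natDegree_eq F α).mpr (hα.trans hfin.symm)
  have hmem : γ ∈ Algebra.adjoin F {α} := by
    rw [← IntermediateField.adjoin_simple_toSubalgebra_of_isAlgebraic hint.isAlgebraic, htop]
    trivial
  rw [Algebra.adjoin_singleton_eq_range_aeval] at hmem
  obtain ⟨p, hp⟩ := hmem
  refine ⟨p %ₘ minpoly F α, ?_, ?_⟩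
  · have := degree_modByMonic_lt p (minpoly.monic hint)
    rwa [degree_eq_natDegree (minpoly.monic hint).ne_zero, hα] at this
  · rw [aeval_modByMonic_eq_self_of_root (minpoly.aeval F α)]
    exact hp

theorem char_monics_eq_zero {F E : Type*} [Field F] [Fintype F] [Field E] [Fintype E] [Algebra F E]
    (q n : ℕ) (hcardF : Fintype.card F = q) (hcardE : Fintype.card E = q ^ n)
    (hn : 1 < n) (α : E) (hα : (minpoly F α).natDegree = n)
    (χ : MulChar E ℂ) (hχ : χ ≠ 1) (k : ℕ) (hk : n ≤ k) :
    ∑ g ∈ monics F k, χ (aeval α g) = 0 := by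
  classical
  choose r hr1 hr2 using exists_low_poly q n hcardF hcardE hn α hα
  have hshift : ∀ s : F[X], s.degree < (n : WithBot ℕ) → ∀ g ∈ monics F k, g + s ∈ monics F k := by
    intro s hs g hg
    rw [mem_monics] at hg ⊢
    have hlt : s.degree < g.degree := by
      rw [degree_eq_natDegree hg.1.ne_zero, hg.2]
      exact hs.trans_le (by exact_mod_cast hk)
    exact ⟨hg.1.add_of_left hlt, by rw [natDegree_add_eq_left_of_degree_lt hlt, hg.2]⟩
  have h1 : ∀ γ : E, ∑ g ∈ monics F k, χ (aeval α g) = ∑ g ∈ monics F k, χ (aeval α g + γ) := by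
    intro γ
    symm
    refine Finset.sum_bij' (fun g _ => g + r γ) (fun g _ => g - r γ) ?_ ?_ ?_ ?_ ?_
    · exact hshift _ (hr1 γ)
    · intro g hg
      rw [sub_eq_add_neg]
      exact hshift _ (by rw [degree_neg]; exact hr1 γ) g hg
    · intros; simp
    · intros; simp
    · intro g _
      simp [hr2]
  have h2 : (Fintype.card E : ℂ) * ∑ g ∈ monics F k, χ (aeval α g) = 0 := by
    calc _ = ∑ γ : E, ∑ g ∈ monics F k, χ (aeval α g) := by simp
      _ = ∑ γ : E, ∑ g ∈ monics F k, χ (aeval α g + γ) := Finset.sum_congr rfl fun γ _ => h1 γ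
      _ = ∑ g ∈ monics F k, ∑ γ : E, χ (aeval α g + γ) := Finset.sum_comm
      _ = ∑ g ∈ monics F k, ∑ γ : E, χ γ := Finset.sum_congr rfl fun g _ =>
          Equiv.sum_comp (Equiv.addLeft (aeval α g)) (fun x => χ x)
      _ = 0 := by rw [MulChar.sum_eq_zero_of_ne_one hχ]; simp
  rcases mul_eq_zero.mp h2 with h | h
  · exact absurd h (by exact_mod_cast Fintype.card_ne_zero)
  · exact h

theorem monics_zero (F : Type*) [Field F] [Finite F] : monics F 0 = {1} := by
  ext g
  rw [mem_monics, Finset.mem_singleton]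
  constructor
  · rintro ⟨h1, h2⟩; exact h1.natDegree_eq_zero.mp h2
  · rintro rfl; simp

theorem weil_bound {F E : Type*} [Field F] [Fintype F] [Field E] [Fintype E] [Algebra F E]
    (q n : ℕ) (hcardF : Fintype.card F = q) (hcardE : Fintype.card E = q ^ n)
    (hn : 1 < n) (α : E) (hα : (minpoly F α).natDegree = n)
    (χ : MulChar E ℂ) (hχ : χ ≠ 1) (d : ℕ) (hd : 1 ≤ d) :
    ‖∑ g ∈ monics F d, (Lam g : ℂ) * χ (aeval α g)‖ ≤ ((n : ℝ) - 1) * Real.sqrt q ^ d := by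
  have hq : 1 < q := hcardF ▸ Fintype.one_lt_card
  obtain ⟨z, hz⟩ := newton_roots (n - 1) (fun k => ∑ g ∈ monics F k, χ (aeval α g))
    (fun k => ∑ g ∈ monics F k, (Lam g : ℂ) * χ (aeval α g))
    (by simp [monics_zero]) (fun k hk => char_monics_eq_zero q n hcardF hcardE hn α hα χ hχ k
      (by omega))
    (fun k => mangoldt_rec (fun g => χ (aeval α g)) (fun g h => by simp) k)
  obtain ⟨A, r0, hA⟩ := exists_extension_bound q n hcardF hcardE hn α hα χ hχ
  have hzn : ∀ i, ‖z i‖ ≤ Real.sqrt q := by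
    intro i
    have h1 := growth_lemma (fun i => z i ^ (n * 2)) ((q : ℝ) ^ n) A (by positivity) (max r0 1)
      (fun r hr => by
        have h2 := hA r (le_trans (le_max_left _ _) hr)
        have h3 : 1 ≤ r := le_trans (le_max_right _ _) hr
        rw [hz (n * (2 * r)) (Nat.mul_pos (by omega) (by omega)), norm_neg] at h2
        simpa only [← pow_mul, mul_assoc] using h2) i
    simp only [norm_pow] at h1
    rw [mul_comm, pow_mul] at h1
    have h4 := le_of_pow_le_pow_left₀ (by omega : n ≠ 0) (by positivity) h1
    exact Real.le_sqrt_of_sq_le h4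
  rw [hz d hd, norm_neg]
  calc ‖∑ i, z i ^ d‖ ≤ ∑ i, ‖z i ^ d‖ := norm_sum_le _ _
    _ ≤ ∑ i : Fin (n - 1), Real.sqrt q ^ d := Finset.sum_le_sum fun i _ => by
        rw [norm_pow]; exact pow_le_pow_left₀ (norm_nonneg _) (hzn i) d
    _ = _ := by
        rw [Finset.sum_const, Finset.card_univ, Fintype.card_fin, nsmul_eq_mul,
          Nat.cast_sub hn.le, Nat.cast_one]

theorem sum_Lam_monics (F : Type*) [Field F] [Fintype F] (d : ℕ) (hd : 1 ≤ d) :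
    ∑ g ∈ monics F d, (Lam g : ℂ) = (Fintype.card F : ℂ) ^ d := by
  obtain ⟨p, hp⟩ := CharP.exists F
  have : Fact p.Prime := ⟨CharP.char_is_prime F p⟩
  have : NeZero d := ⟨by omega⟩
  let K := FiniteField.Extension F p d
  letI : Fintype K := Fintype.ofFinite K
  have hK : Fintype.card K = Fintype.card F ^ d := by
    rw [← Nat.card_eq_fintype_card, FiniteField.natCard_extension, Nat.card_eq_fintype_card]
  have hfin : Module.finrank F K = d := by
    have h1 := Module.card_eq_pow_finrank (K := F) (V := K)
    rw [hK] at h1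
    exact (Nat.pow_right_injective (Fintype.one_lt_card : 1 < Fintype.card F) h1).symm
  have h := sum_cpoly (F := F) (K := K) (fun _ => 1)
  rw [hfin] at h
  simp only [mul_one, Finset.sum_const, Finset.card_univ, nsmul_eq_mul, hK] at h
  rw [← h]; push_cast; rfl

theorem sum_mulChar_eq {E : Type*} [Field E] [Fintype E] [Fintype (MulChar E ℂ)]
    [DecidableEq E] (a : E) :
    ∑ χ : MulChar E ℂ, χ a = if a = 1 then ((Fintype.card E : ℂ) - 1) else 0 := by
  have : NeZero ((Monoid.exponent Eˣ : ℕ) : ℂ) :=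
    ⟨by exact_mod_cast Monoid.exponent_ne_zero_of_finite⟩
  split_ifs with ha
  · subst ha
    have h := MulChar.card_eq_card_units_of_hasEnoughRootsOfUnity E ℂ
    rw [Nat.card_eq_fintype_card, Nat.card_eq_fintype_card, Fintype.card_units] at h
    simp only [map_one, Finset.sum_const, Finset.card_univ, nsmul_eq_mul, mul_one, h]
    rw [Nat.cast_sub Fintype.card_pos, Nat.cast_one]
  · obtain ⟨χ, hχ⟩ := MulChar.exists_apply_ne_one_of_hasEnoughRootsOfUnity E ℂ ha
    refine eq_zero_of_mul_eq_self_left hχ ?_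
    simp only [Finset.mul_sum, ← MulChar.mul_apply]
    exact Fintype.sum_bijective _ (Group.mulLeft_bijective χ) _ _ fun χ' ↦ rfl

theorem norm_mulChar_le_one {E : Type*} [Field E] [Fintype E] (χ : MulChar E ℂ) (β : Eˣ) :
    ‖χ (β : E)‖ ≤ 1 := by
  refine (Complex.norm_eq_one_of_pow_eq_one (n := Fintype.card E - 1) ?_ ?_).le
  · rw [← map_pow, FiniteField.pow_card_sub_one_eq_one _ β.ne_zero, map_one]
  · have : 1 < Fintype.card E := Fintype.one_lt_card
    omega

open Classical in
theorem finsum_eq_finset {F E : Type*} [Field F] [Fintype F] [Field E] [Fintype E] [Algebra F E]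
    (d k : ℕ) (α : E) (β : E) :
    (∑ᶠ (g : Fin k → Polynomial F)
        (_ : (∀ i, g i ∈ primarySet F d) ∧ ∏ i, Polynomial.aeval α (g i) = β),
        ∏ i, (Lam (g i) : ℝ)) =
    ∑ g ∈ Fintype.piFinset (fun _ : Fin k => monics F d) with ∏ i, aeval α (g i) = β,
      ∏ i, (Lam (g i) : ℝ) := by
  refine finsum_mem_eq_sum_of_inter_support_eq
    (s := {g : Fin k → Polynomial F | (∀ i, g i ∈ primarySet F d) ∧
      ∏ i, Polynomial.aeval α (g i) = β}) _ ?_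
  ext g
  simp only [Set.mem_inter_iff, Function.mem_support, Finset.coe_filter, Fintype.mem_piFinset,
    Set.mem_ofPred_eq, mem_monics, primarySet]
  constructor
  · rintro ⟨⟨h1, h2⟩, h3⟩
    exact ⟨⟨fun i => ⟨(h1 i).1, (h1 i).2.1⟩, h2⟩, h3⟩
  · rintro ⟨⟨h1, h2⟩, h3⟩
    refine ⟨⟨fun i => ⟨(h1 i).1, (h1 i).2, ?_⟩, h2⟩, h3⟩
    by_contra h
    apply h3
    exact Finset.prod_eq_zero (Finset.mem_univ i) (by rw [Lam_eq_zero h]; simp)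

open Classical in
theorem count_eq_char_sum {F E : Type*} [Field F] [Fintype F] [Field E] [Fintype E] [Algebra F E]
    [Fintype (MulChar E ℂ)] (d k : ℕ) (α : E) (β : Eˣ) :
    ((Fintype.card E : ℂ) - 1) *
      ∑ g ∈ Fintype.piFinset (fun _ : Fin k => monics F d) with ∏ i, aeval α (g i) = (β : E),
      ∏ i, (Lam (g i) : ℂ) =
    ∑ χ : MulChar E ℂ, χ ((β⁻¹ : Eˣ) : E) *
      (∑ g ∈ monics F d, (Lam g : ℂ) * χ (aeval α g)) ^ k := by
  have h1 : ∀ χ : MulChar E ℂ, (∑ g ∈ monics F d, (Lam g : ℂ) * χ (aeval α g)) ^ k =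
      ∑ g ∈ Fintype.piFinset (fun _ : Fin k => monics F d),
        (∏ i, (Lam (g i) : ℂ)) * χ (∏ i, aeval α (g i)) := by
    intro χ
    have h := Finset.prod_univ_sum (fun _ : Fin k => monics F d)
      (fun _ g => (Lam g : ℂ) * χ (aeval α g))
    rw [Finset.prod_const, Finset.card_univ, Fintype.card_fin] at h
    rw [h]
    refine Finset.sum_congr rfl fun g _ => ?_
    rw [Finset.prod_mul_distrib, map_prod]
  simp_rw [h1, Finset.mul_sum]
  rw [Finset.sum_comm, Finset.sum_filter]
  refine Finset.sum_congr rfl fun g _ => ?_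
  have h2 : ∀ χ : MulChar E ℂ, χ ((β⁻¹ : Eˣ) : E) * ((∏ i, (Lam (g i) : ℂ)) *
      χ (∏ i, aeval α (g i))) =
      (∏ i, (Lam (g i) : ℂ)) * χ (((β⁻¹ : Eˣ) : E) * ∏ i, aeval α (g i)) := by
    intro χ
    rw [map_mul]; ring
  simp_rw [h2]
  rw [← Finset.mul_sum, sum_mulChar_eq]
  have h3 : ((β⁻¹ : Eˣ) : E) * ∏ i, aeval α (g i) = 1 ↔ ∏ i, aeval α (g i) = (β : E) := by
    rw [Units.inv_mul_eq_one, eq_comm]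
  simp only [h3]
  split_ifs
  · ring
  · simp

/-- The weighted representation count `M_k(β)` satisfies
`|M_k(β) - q^{kd}/(q^n-1)| < (n-1)^k q^{kd/2}`. -/
theorem weighted_count_estimate
    {F E : Type*} [Field F] [Fintype F] [Field E] [Fintype E] [Algebra F E]
    (q n d k : ℕ) (hq : IsPrimePow q)
    (hcardF : Fintype.card F = q) (hcardE : Fintype.card E = q ^ n)
    (hn : 1 < n) (hd : 1 ≤ d) (hdn : d < n) (hk : 1 ≤ k)
    (α : E) (hα : (minpoly F α).natDegree = n) (β : Eˣ) :
    |(∑ᶠ (g : Fin k → Polynomial F)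
        (_ : (∀ i, g i ∈ primarySet F d) ∧ ∏ i, Polynomial.aeval α (g i) = (β : E)),
        ∏ i, (Lam (g i) : ℝ)) - (q : ℝ) ^ (k * d) / ((q : ℝ) ^ n - 1)|
      < ((n : ℝ) - 1) ^ k * (q : ℝ) ^ (((k * d : ℕ) : ℝ) / 2) := by
  classical
  rw [finsum_eq_finset]
  set M : ℝ := ∑ g ∈ Fintype.piFinset (fun _ : Fin k => monics F d) with
    ∏ i, aeval α (g i) = (β : E), ∏ i, (Lam (g i) : ℝ) with hM
  letI : Fintype (MulChar E ℂ) := Fintype.ofFinite _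
  have hq1 : 1 < q := hcardF ▸ Fintype.one_lt_card
  have hcount := count_eq_char_sum (F := F) d k α β
  have hMC : (∑ g ∈ Fintype.piFinset (fun _ : Fin k => monics F d) with
      ∏ i, aeval α (g i) = (β : E), ∏ i, (Lam (g i) : ℂ)) = (M : ℂ) := by
    rw [hM]; push_cast; rfl
  rw [hMC, ← Finset.add_sum_erase _ _ (Finset.mem_univ (1 : MulChar E ℂ))] at hcount
  have hone : ((1 : MulChar E ℂ) ((β⁻¹ : Eˣ) : E) *
      (∑ g ∈ monics F d, (Lam g : ℂ) * (1 : MulChar E ℂ) (aeval α g)) ^ k) =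
      (q : ℂ) ^ (k * d) := by
    rw [MulChar.one_apply_coe, one_mul]
    have : ∑ g ∈ monics F d, (Lam g : ℂ) * (1 : MulChar E ℂ) (aeval α g) = (q : ℂ) ^ d := by
      rw [← hcardF, ← sum_Lam_monics F d hd]
      refine Finset.sum_congr rfl fun g hg => ?_
      rw [mem_monics] at hg
      have hne : aeval α g ≠ 0 := by
        intro h0
        have := natDegree_le_of_dvd (minpoly.dvd F α h0) hg.1.ne_zero
        omega
      rw [MulChar.one_apply hne.isUnit, mul_one]
    rw [this, ← pow_mul, mul_comm]
  rw [hone] at hcount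
  have hcE : (Fintype.card E : ℂ) - 1 = (((q : ℝ) ^ n - 1 : ℝ) : ℂ) := by
    rw [hcardE]; push_cast; rfl
  set Q : ℝ := (q : ℝ) ^ n - 1 with hQ
  have hQ1 : 1 ≤ Q := by
    have h2 : (2 : ℝ) ≤ q := by exact_mod_cast hq1
    have : (2 : ℝ) ^ 1 ≤ (q : ℝ) ^ n := by
      calc (2 : ℝ) ^ 1 ≤ 2 ^ n := pow_le_pow_right₀ (by norm_num) hn.le
        _ ≤ _ := pow_le_pow_left₀ (by norm_num) h2 n
    linarith
  set B : ℝ := ((n : ℝ) - 1) ^ k * (q : ℝ) ^ (((k * d : ℕ) : ℝ) / 2) with hB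
  have hn1 : (0 : ℝ) < (n : ℝ) - 1 := by
    have : (1 : ℝ) < n := by exact_mod_cast hn
    linarith
  have hB0 : 0 < B := by positivity
  have hBe : (((n : ℝ) - 1) * Real.sqrt q ^ d) ^ k = B := by
    rw [hB, mul_pow, ← pow_mul, Real.sqrt_eq_rpow, ← Real.rpow_natCast _ (d * k),
      ← Real.rpow_mul (by positivity)]
    congr 2
    push_cast; ring
  have hcardMC : (Fintype.card (MulChar E ℂ) : ℝ) = Q := by
    have h := sum_mulChar_eq (1 : E)
    rw [if_pos rfl, hcE] at h
    simp only [map_one, Finset.sum_const, Finset.card_univ, nsmul_eq_mul, mul_one] at h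
    exact_mod_cast h
  have hbound : ‖(Q : ℂ) * M - (q : ℂ) ^ (k * d)‖ ≤ (Q - 1) * B := by
    rw [← hcE, hcount, add_sub_cancel_left]
    refine (norm_sum_le _ _).trans ?_
    calc _ ≤ ∑ χ ∈ (Finset.univ : Finset (MulChar E ℂ)).erase 1, B := by
          refine Finset.sum_le_sum fun χ hχ => ?_
          rw [norm_mul, norm_pow, ← hBe]
          have h1 := weil_bound q n hcardF hcardE hn α hα χ (Finset.ne_of_mem_erase hχ) d hd
          have h2 := norm_mulChar_le_one χ β⁻¹
          calc _ ≤ 1 * _ := mul_le_mul_of_nonneg_right h2 (by positivity)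
            _ ≤ _ := by
              rw [one_mul]
              exact pow_le_pow_left₀ (norm_nonneg _) h1 k
      _ = (Q - 1) * B := by
          rw [Finset.sum_const, Finset.card_erase_of_mem (Finset.mem_univ _), Finset.card_univ,
            nsmul_eq_mul, Nat.cast_sub Fintype.card_pos, hcardMC, Nat.cast_one]
  have hreal : |Q * M - (q : ℝ) ^ (k * d)| ≤ (Q - 1) * B := by
    rw [← Real.norm_eq_abs, ← Complex.norm_real]
    refine le_trans (le_of_eq ?_) hbound
    push_cast; rfl
  have hQ0 : 0 < Q := by linarith
  have heq : M - (q : ℝ) ^ (k * d) / Q = (Q * M - (q : ℝ) ^ (k * d)) / Q := by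
    field_simp
  rw [heq, abs_div, abs_of_pos hQ0, div_lt_iff₀ hQ0]
  nlinarith
end
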